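/- For every integer d ≥ 4, q_d^{(2)}(n) is asymptotically equivalent, as n → ∞ through the positive integers, to (A_d^{1/4} / (2 √(π α_d^{d−3} (d α_d^{d−1} + 1)))) · n^{−3/4} · exp(2 √(A_d n)); that is, the ratio of q_d^{(2)}(n) to this expression tends to 1. -/

import Mathlib

open Filter Real

/-- q_d^{(a)}(n): the number of partitions of n into parts each ≥ a in which
any two parts differ by at least d. -/
def qPart (d a n : ℕ) : ℕ :=
  Fintype.card {p : Nat.Partition n //
    (∀ i ∈ p.parts, a ≤ i) ∧
    ∀ i ∈ p.parts, p.parts.count i = 1 ∧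
      ∀ j ∈ p.parts, j ≠ i → (d : ℤ) ≤ |(i : ℤ) - (j : ℤ)|}

/-- Bounded holomorphic functions on a disc that tend to zero at positive reals near the centre
tend to zero at the centre. -/
theorem tendsto_zero_at_center {ι : Type*} {l : Filter ι} {h : ι → ℂ → ℂ} {R B : ℝ} (hR : 0 < R)
    (hB : 0 < B) (hd : ∀ᶠ i in l, DifferentiableOn ℂ (h i) (Metric.ball 0 R))
    (hb : ∀ᶠ i in l, ∀ z ∈ Metric.ball (0 : ℂ) R, ‖h i z‖ ≤ B)
    (hr : ∀ x : ℝ, 0 < x → x < R → Tendsto (fun i => h i x) l (nhds 0)) :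
    Tendsto (fun i => h i 0) l (nhds 0) := by
  rw [Metric.tendsto_nhds]
  intro ε hε
  set x : ℝ := min (R / 2) (ε * R / (8 * B)) with hx
  have hx0 : 0 < x := by positivity
  have hxR : x < R := (min_le_left _ _).trans_lt (by linarith)
  have hxε : 2 * B / R * x ≤ ε / 4 := by
    calc 2 * B / R * x ≤ 2 * B / R * (ε * R / (8 * B)) := by gcongr; exact min_le_right _ _
      _ = ε / 4 := by field_simp; norm_num
  have h1 := (Metric.tendsto_nhds.1 (hr x hx0 hxR)) (ε / 2) (by positivity)
  filter_upwards [hd, hb, h1] with i hdi hbi h1i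
  have hmem : (x : ℂ) ∈ Metric.ball (0 : ℂ) R := by
    simp [abs_of_pos hx0, hxR]
  have hmaps : Set.MapsTo (h i) (Metric.ball 0 R) (Metric.closedBall (h i 0) (2 * B)) := by
    intro w hw
    rw [mem_closedBall_iff_norm]
    have h2 := hbi w hw
    have h3 := hbi 0 (Metric.mem_ball_self hR)
    have h4 := norm_sub_le (h i w) (h i 0)
    linarith
  have h2 := Complex.dist_le_div_mul_dist_of_mapsTo_ball hdi hmaps hmem
  have h3 : dist (x : ℂ) 0 = x := by simp [abs_of_pos hx0]
  rw [h3] at h2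
  have h4 := dist_triangle_left (h i 0) 0 (h i x)
  linarith

theorem eventually_norm_le_of_tendsto_zero_real {ι : Type*} {l : Filter ι} {R : ℝ} (hR : 0 < R)
    {z : ℂ} (hz : ‖z‖ < R) (K : ℕ) : ∀ {h : ι → ℂ → ℂ} {B : ℝ}, 0 < B →
    (∀ᶠ i in l, DifferentiableOn ℂ (h i) (Metric.ball 0 R)) →
    (∀ᶠ i in l, ∀ w ∈ Metric.ball (0 : ℂ) R, ‖h i w‖ ≤ B) →
    (∀ x : ℝ, 0 < x → x < R → Tendsto (fun i => h i x) l (nhds 0)) →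
    ∀ ε > 0, ∀ᶠ i in l, ‖h i z‖ ≤ ε + B * (2 * ‖z‖ / R) ^ K := by
  induction K with
  | zero =>
    intro h B hB hd hb hr ε hε
    filter_upwards [hb] with i hi
    have := hi z (by simpa using hz)
    simp; linarith
  | succ K ih =>
    intro h B hB hd hb hr ε hε
    have h0 := tendsto_zero_at_center hR hB hd hb hr
    have hmaps : ∀ᶠ i in l,
        Set.MapsTo (h i) (Metric.ball 0 R) (Metric.closedBall (h i 0) (2 * B)) := by
      filter_upwards [hb] with i hbi w hw
      rw [mem_closedBall_iff_norm]
      have h2 := hbi w hw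
      have h3 := hbi 0 (Metric.mem_ball_self hR)
      have h4 := norm_sub_le (h i w) (h i 0)
      linarith
    have key := ih (h := fun i => dslope (h i) 0) (B := 2 * B / R) (by positivity)
      (by
        filter_upwards [hd] with i hi
        exact (Complex.differentiableOn_dslope (Metric.ball_mem_nhds 0 hR)).2 hi)
      (by
        filter_upwards [hd, hmaps] with i hi hm w hw
        exact Complex.norm_dslope_le_div_of_mapsTo_ball hi hm hw)
      (by
        intro x hx hxR
        have hx' : (x : ℂ) ≠ 0 := by exact_mod_cast hx.ne'
        have : (fun i => dslope (h i) 0 (x : ℂ)) = fun i => (x : ℂ)⁻¹ * (h i x - h i 0) := by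
          funext i
          rw [dslope_of_ne _ hx', slope_def_field]
          field_simp
          ring
        rw [this]
        simpa using ((hr x hx hxR).sub h0).const_mul (x : ℂ)⁻¹)
      (ε / (2 * R)) (by positivity)
    filter_upwards [key, (Metric.tendsto_nhds.1 h0) (ε / 2) (by positivity)] with i h1 h2
    rw [dist_zero_right] at h2
    have h3 : h i z = h i 0 + z * dslope (h i) 0 z := by
      have := sub_smul_dslope (h i) 0 z
      simp only [sub_zero, smul_eq_mul] at this
      rw [this]; ring
    rw [h3]
    calc ‖h i 0 + z * dslope (h i) 0 z‖ ≤ ‖h i 0‖ + ‖z‖ * ‖dslope (h i) 0 z‖ := by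
          rw [← norm_mul]; exact norm_add_le _ _
      _ ≤ ε / 2 + ‖z‖ * (ε / (2 * R) + 2 * B / R * (2 * ‖z‖ / R) ^ K) := by gcongr
      _ = ε / 2 + ‖z‖ * (ε / (2 * R)) + B * (2 * ‖z‖ / R) ^ (K + 1) := by
          rw [pow_succ]; field_simp; ring
      _ ≤ ε / 2 + R * (ε / (2 * R)) + B * (2 * ‖z‖ / R) ^ (K + 1) := by gcongr
      _ = ε + B * (2 * ‖z‖ / R) ^ (K + 1) := by field_simp; ring

/-- A form of Vitali's theorem: a bounded family of holomorphic functions on a disc of radius `R`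
tending to zero at the positive reals tends to zero on the disc of radius `R / 2`. -/
theorem tendsto_zero_of_tendsto_zero_real {ι : Type*} {l : Filter ι} {h : ι → ℂ → ℂ} {R B : ℝ}
    (hB : 0 < B) (hd : ∀ᶠ i in l, DifferentiableOn ℂ (h i) (Metric.ball 0 R))
    (hb : ∀ᶠ i in l, ∀ z ∈ Metric.ball (0 : ℂ) R, ‖h i z‖ ≤ B)
    (hr : ∀ x : ℝ, 0 < x → x < R → Tendsto (fun i => h i x) l (nhds 0))
    {z : ℂ} (hz : 2 * ‖z‖ < R) : Tendsto (fun i => h i z) l (nhds 0) := by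
  have hR : 0 < R := by linarith [norm_nonneg z]
  have hρ : 2 * ‖z‖ / R < 1 := by rw [div_lt_one hR]; exact hz
  have hpow := (tendsto_pow_atTop_nhds_zero_of_lt_one (by positivity) hρ).const_mul B
  rw [mul_zero] at hpow
  rw [Metric.tendsto_nhds]
  intro ε hε
  obtain ⟨K, hK⟩ := (hpow.eventually (gt_mem_nhds (half_pos hε))).exists
  filter_upwards [eventually_norm_le_of_tendsto_zero_real hR (by linarith [norm_nonneg z] : ‖z‖ < R)
    K hB hd hb hr (ε / 4) (by positivity)] with i hi
  rw [dist_zero_right]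
  linarith

/-- The list `l` has entries at least `a` and increases by steps of at least `d`. -/
def GapList (d a : ℕ) (l : List ℕ) : Prop :=
  (∀ i ∈ l, a ≤ i) ∧ l.Pairwise fun i j => i + d ≤ j

theorem gapList_nil (d a : ℕ) : GapList d a [] := by simp [GapList]

theorem gapList_cons {d a b : ℕ} {l : List ℕ} :
    GapList d a (b :: l) ↔ a ≤ b ∧ GapList d (b + d) l := by
  simp only [GapList, List.mem_cons, forall_eq_or_imp, List.pairwise_cons]
  constructor
  · rintro ⟨⟨h1, -⟩, h3, h4⟩
    exact ⟨h1, h3, h4⟩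
  · rintro ⟨h1, h3, h4⟩
    exact ⟨⟨h1, fun i hi => by have := h3 i hi; omega⟩, h3, h4⟩

theorem sort_coe_eq_of_gapList {d a : ℕ} {l : List ℕ} (h : GapList d a l) :
    Multiset.sort (l : Multiset ℕ) (· ≤ ·) = l := by
  apply List.Perm.eq_of_pairwise' (r := (· ≤ ·))
  · exact Multiset.pairwise_sort _ _
  · exact h.2.imp fun hij => by omega
  · rw [← Multiset.coe_eq_coe, Multiset.sort_eq]

theorem gapList_iff_of_pairwise_le {d a : ℕ} (hd : 1 ≤ d) {l : List ℕ}
    (hl : l.Pairwise (· ≤ ·)) :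
    GapList d a l ↔ (∀ i ∈ (l : Multiset ℕ), a ≤ i) ∧
      ∀ i ∈ (l : Multiset ℕ), (l : Multiset ℕ).count i = 1 ∧
        ∀ j ∈ (l : Multiset ℕ), j ≠ i → (d : ℤ) ≤ |(i : ℤ) - (j : ℤ)| := by
  simp only [Multiset.mem_coe, Multiset.coe_count, GapList]
  refine and_congr_right fun _ => ⟨fun h i hi => ⟨?_, fun j hj hji => ?_⟩, fun h => ?_⟩
  · refine List.count_eq_one_of_mem ?_ hi
    exact h.imp fun hij => by omega
  · have hsymm : Std.Symm fun i j : ℕ => j ≠ i → (d : ℤ) ≤ |(i : ℤ) - (j : ℤ)| :=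
      ⟨fun x y hxy hne => by rw [abs_sub_comm]; exact hxy hne.symm⟩
    refine List.Pairwise.forall_of_forall
      (R := fun i j : ℕ => j ≠ i → (d : ℤ) ≤ |(i : ℤ) - (j : ℤ)|)
      (fun x _ hx => absurd rfl hx) (h.imp fun {x y} hxy _ => ?_) hi hj hji
    rw [abs_sub_comm]
    exact le_trans (by omega) (le_abs_self _)
  · have hnd : l.Nodup := by
      rw [List.nodup_iff_count_le_one]
      intro i
      by_cases hi : i ∈ l
      · exact (h i hi).1.le
      · rw [List.count_eq_zero_of_not_mem hi]; omega
    refine (hl.and hnd).imp_of_mem fun {x y} hx hy hxy => ?_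
    have := (h x hx).2 y hy (Ne.symm hxy.2)
    have h2 := hxy.1
    rw [abs_sub_comm, abs_of_nonneg (by omega)] at this
    omega

/-- Partitions counted by `qPart` correspond to increasing lists with gaps. -/
def gapListEquiv (d a n : ℕ) (hd : 1 ≤ d) (ha : 1 ≤ a) :
    {l : List ℕ // GapList d a l ∧ l.sum = n} ≃
      {p : Nat.Partition n // (∀ i ∈ p.parts, a ≤ i) ∧
        ∀ i ∈ p.parts, p.parts.count i = 1 ∧
          ∀ j ∈ p.parts, j ≠ i → (d : ℤ) ≤ |(i : ℤ) - (j : ℤ)|} where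
  toFun l := ⟨⟨(l.1 : Multiset ℕ),
      fun {i} hi => lt_of_lt_of_le ha (l.2.1.1 i hi), by simpa using l.2.2⟩,
    (gapList_iff_of_pairwise_le hd (l.2.1.2.imp fun hij => by omega)).1 l.2.1⟩
  invFun p := ⟨p.1.parts.sort (· ≤ ·), by
    refine ⟨(gapList_iff_of_pairwise_le hd (Multiset.pairwise_sort _ _)).2 ?_, ?_⟩
    · rw [Multiset.sort_eq]; exact p.2
    · rw [← Multiset.sum_coe, Multiset.sort_eq, p.1.parts_sum]⟩
  left_inv l := Subtype.ext (sort_coe_eq_of_gapList l.2.1)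
  right_inv p := by
    apply Subtype.ext
    apply Nat.Partition.ext
    exact Multiset.sort_eq _ _

theorem finite_gapList (d a n : ℕ) (hd : 1 ≤ d) (ha : 1 ≤ a) :
    Finite {l : List ℕ // GapList d a l ∧ l.sum = n} :=
  Finite.of_equiv _ (gapListEquiv d a n hd ha).symm

theorem qPart_eq_card (d a n : ℕ) (hd : 1 ≤ d) (ha : 1 ≤ a) :
    qPart d a n = Nat.card {l : List ℕ // GapList d a l ∧ l.sum = n} := by
  rw [Nat.card_congr (gapListEquiv d a n hd ha), Nat.card_eq_fintype_card, qPart]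

/-- Splitting off the smallest entry of a gap list of length `k + 1`. -/
def gapListConsEquiv (d a k : ℕ) :
    (Σ m : ℕ, {l : List ℕ // GapList d (a + m + d) l ∧ l.length = k}) ≃
      {l : List ℕ // GapList d a l ∧ l.length = k + 1} where
  toFun s := ⟨(a + s.1) :: s.2.1, gapList_cons.2 ⟨by omega, s.2.2.1⟩, by simp [s.2.2.2]⟩
  invFun l := match l with
    | ⟨b :: l', h⟩ => ⟨b - a, l', by
        have := gapList_cons.1 h.1
        rw [Nat.add_sub_cancel' this.1]
        exact this.2, by simpa using h.2⟩
  left_inv := by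
    rintro ⟨m, l, h1, h2⟩
    have hm : a + m - a = m := by omega
    simp only
    congr 1
    refine (Subtype.heq_iff_coe_eq ?_).2 rfl
    intro x
    rw [hm]
  right_inv := by
    rintro ⟨_ | ⟨b, l⟩, h1, h2⟩
    · simp at h2
    · apply Subtype.ext
      have := (gapList_cons.1 h1).1
      simp only [List.cons.injEq, and_true]
      omega

/-- The generating function of gap lists of length `k`. -/
noncomputable def gapTerm {K : Type*} [Field K] (d a : ℕ) (x : K) (k : ℕ) : K :=
  x ^ (a * k + d * k.choose 2) / ∏ j ∈ Finset.range k, (1 - x ^ (j + 1))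

theorem gapTerm_succ {K : Type*} [Field K] (d a m : ℕ) (x : K) (k : ℕ) :
    x ^ (a + m) * gapTerm d (a + m + d) x k =
      x ^ (a * (k + 1) + d * (k + 1).choose 2) /
        (∏ j ∈ Finset.range k, (1 - x ^ (j + 1))) * (x ^ (k + 1)) ^ m := by
  have h : (k + 1).choose 2 = k + k.choose 2 := by
    rw [Nat.choose_succ_succ' k 1, Nat.choose_one_right]
  rw [gapTerm, h, mul_div_assoc', div_mul_eq_mul_div, ← pow_add, ← pow_mul, ← pow_add]
  congr 2
  ring

theorem hasSum_gapTerm_succ {𝕜 : Type*} [RCLike 𝕜] (d a : ℕ) {x : 𝕜} (hx : ‖x‖ < 1) (k : ℕ) :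
    HasSum (fun m => x ^ (a + m) * gapTerm d (a + m + d) x k) (gapTerm d a x (k + 1)) := by
  simp_rw [gapTerm_succ]
  have h1 : ‖x ^ (k + 1)‖ < 1 := by
    rw [norm_pow]; exact pow_lt_one₀ (norm_nonneg _) hx (by omega)
  have h := (hasSum_geometric_of_norm_lt_one h1).mul_left
    (x ^ (a * (k + 1) + d * (k + 1).choose 2) / ∏ j ∈ Finset.range k, (1 - x ^ (j + 1)))
  convert h using 1
  · rfl
  · rw [gapTerm, Finset.prod_range_succ, ← div_eq_mul_inv, div_div]

theorem hasSum_gapList_length_zero {K : Type*} [Field K] [TopologicalSpace K] (d a : ℕ) (x : K) :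
    HasSum (fun l : {l : List ℕ // GapList d a l ∧ l.length = 0} => x ^ l.1.sum)
      (gapTerm d a x 0) := by
  let _ : Unique {l : List ℕ // GapList d a l ∧ l.length = 0} :=
    { default := ⟨[], gapList_nil d a, rfl⟩
      uniq := fun l => Subtype.ext (List.length_eq_zero_iff.1 l.2.2) }
  have h := hasSum_unique (fun l : {l : List ℕ // GapList d a l ∧ l.length = 0} => x ^ l.1.sum)
  have h0 : gapTerm d a x 0 = x ^ ([] : List ℕ).sum := by simp [gapTerm]
  rw [h0]
  exact h

theorem hasSum_gapList_real (d : ℕ) {r : ℝ} (hr : 0 ≤ r) (hr1 : r < 1) (k : ℕ) : ∀ a,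
    HasSum (fun l : {l : List ℕ // GapList d a l ∧ l.length = k} => r ^ l.1.sum)
      (gapTerm d a r k) := by
  induction k with
  | zero =>
    exact fun a => hasSum_gapList_length_zero d a _
  | succ k ih =>
    intro a
    rw [← (gapListConsEquiv d a k).hasSum_iff]
    have hinner : ∀ m : ℕ, HasSum
        (fun l : {l : List ℕ // GapList d (a + m + d) l ∧ l.length = k} =>
          ((fun l => r ^ l.1.sum) ∘ gapListConsEquiv d a k) ⟨m, l⟩)
        (r ^ (a + m) * gapTerm d (a + m + d) r k) := by
      intro m
      convert (ih (a + m + d)).mul_left (r ^ (a + m)) using 2 with l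
      · rfl
      · simp [gapListConsEquiv, pow_add]
    have hout := hasSum_gapTerm_succ d a (x := r) (by rwa [Real.norm_of_nonneg hr]) k
    refine hout.sigma_of_hasSum hinner ?_
    rw [summable_sigma_of_nonneg]
    · refine ⟨fun m => (hinner m).summable, ?_⟩
      simp_rw [fun m => (hinner m).tsum_eq]
      exact hout.summable
    · intro s
      exact pow_nonneg hr _

theorem hasSum_gapList_complex (d : ℕ) {x : ℂ} (hx : ‖x‖ < 1) (k : ℕ) : ∀ a,
    HasSum (fun l : {l : List ℕ // GapList d a l ∧ l.length = k} => x ^ l.1.sum)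
      (gapTerm d a x k) := by
  induction k with
  | zero =>
    exact fun a => hasSum_gapList_length_zero d a _
  | succ k ih =>
    intro a
    have hs := (hasSum_gapList_real d (norm_nonneg x) hx (k + 1) a).summable
    rw [← (gapListConsEquiv d a k).hasSum_iff]
    refine (hasSum_gapTerm_succ d a hx k).sigma_of_hasSum (fun m => ?_) ?_
    · convert (ih (a + m + d)).mul_left (x ^ (a + m)) using 2 with l
      · rfl
      · simp [gapListConsEquiv, pow_add]
    · rw [(gapListConsEquiv d a k).summable_iff]
      refine Summable.of_norm ?_
      simpa only [norm_pow] using hs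

theorem prod_one_sub_pow_pos {r : ℝ} (hr : 0 ≤ r) (hr1 : r < 1) (k : ℕ) :
    0 < ∏ j ∈ Finset.range k, (1 - r ^ (j + 1)) :=
  Finset.prod_pos fun j _ => sub_pos.2 (pow_lt_one₀ hr hr1 (by omega))

theorem gapTerm_pos (d a : ℕ) {r : ℝ} (hr : 0 < r) (hr1 : r < 1) (k : ℕ) :
    0 < gapTerm d a r k :=
  div_pos (pow_pos hr _) (prod_one_sub_pow_pos hr.le hr1 k)

theorem gapTerm_succ_eq_mul {K : Type*} [Field K] (d a : ℕ) (x : K) (k : ℕ) :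
    gapTerm d a x (k + 1) = gapTerm d a x k * (x ^ (a + d * k) / (1 - x ^ (k + 1))) := by
  have h : (k + 1).choose 2 = k + k.choose 2 := by
    rw [Nat.choose_succ_succ' k 1, Nat.choose_one_right]
  rw [gapTerm, gapTerm, Finset.prod_range_succ, h, div_mul_div_comm, ← pow_add]
  congr 2
  ring

theorem summable_gapTerm {d : ℕ} (hd : 1 ≤ d) (a : ℕ) {r : ℝ} (hr : 0 < r) (hr1 : r < 1) :
    Summable (gapTerm d a r) := by
  refine summable_of_ratio_test_tendsto_lt_one (l := 0) one_pos
    (Eventually.of_forall fun k => (gapTerm_pos d a hr hr1 k).ne') ?_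
  have h : (fun k => ‖gapTerm d a r (k + 1)‖ / ‖gapTerm d a r k‖) =
      fun k => r ^ a * (r ^ d) ^ k / (1 - r * r ^ k) := by
    funext k
    have h1 := gapTerm_pos d a hr hr1 k
    have h2 := gapTerm_pos d a hr hr1 (k + 1)
    rw [Real.norm_of_nonneg h1.le, Real.norm_of_nonneg h2.le, gapTerm_succ_eq_mul,
      mul_div_cancel_left₀ _ h1.ne', pow_add, pow_mul, pow_succ' r k]
  rw [h]
  have h1 := tendsto_pow_atTop_nhds_zero_of_lt_one hr.le hr1
  have h2 := tendsto_pow_atTop_nhds_zero_of_lt_one (pow_nonneg hr.le d)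
    (pow_lt_one₀ hr.le hr1 (by omega))
  have h3 := (h2.const_mul (r ^ a)).div ((h1.const_mul r).const_sub 1) (by simp)
  simp only [mul_zero, zero_div] at h3
  exact h3

/-- Sorting gap lists by length. -/
def gapListLengthEquiv (d a : ℕ) :
    (Σ k : ℕ, {l : List ℕ // GapList d a l ∧ l.length = k}) ≃ {l : List ℕ // GapList d a l} where
  toFun s := ⟨s.2.1, s.2.2.1⟩
  invFun l := ⟨l.1.length, l.1, l.2, rfl⟩
  left_inv := by rintro ⟨k, l, h, rfl⟩; rfl
  right_inv _ := rfl

/-- Sorting gap lists by sum. -/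
def gapListSumEquiv (d a : ℕ) :
    (Σ n : ℕ, {l : List ℕ // GapList d a l ∧ l.sum = n}) ≃ {l : List ℕ // GapList d a l} where
  toFun s := ⟨s.2.1, s.2.2.1⟩
  invFun l := ⟨l.1.sum, l.1, l.2, rfl⟩
  left_inv := by rintro ⟨k, l, h, rfl⟩; rfl
  right_inv _ := rfl

theorem summable_gapList {d : ℕ} (hd : 1 ≤ d) (a : ℕ) {r : ℝ} (hr : 0 < r) (hr1 : r < 1) :
    Summable (fun l : {l : List ℕ // GapList d a l} => r ^ l.1.sum) := by
  rw [← (gapListLengthEquiv d a).summable_iff, summable_sigma_of_nonneg]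
  · refine ⟨fun k => (hasSum_gapList_real d hr.le hr1 k a).summable, ?_⟩
    refine (summable_gapTerm hd a hr hr1).congr fun k => ?_
    exact (hasSum_gapList_real d hr.le hr1 k a).tsum_eq.symm
  · intro s
    exact pow_nonneg hr.le _

theorem norm_gapTerm_le (d a : ℕ) {x : ℂ} (hx : ‖x‖ < 1) (k : ℕ) :
    ‖gapTerm d a x k‖ ≤ gapTerm d a ‖x‖ k := by
  rw [gapTerm, gapTerm, norm_div, norm_pow, norm_prod]
  refine div_le_div_of_nonneg_left (pow_nonneg (norm_nonneg _) _)
    (prod_one_sub_pow_pos (norm_nonneg _) hx k) ?_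
  refine Finset.prod_le_prod (fun j _ => sub_nonneg.2 (pow_le_one₀ (norm_nonneg _) hx.le))
    fun j _ => ?_
  have := norm_sub_norm_le (1 : ℂ) (x ^ (j + 1))
  rwa [norm_one, norm_pow] at this

theorem summable_norm_gapTerm {d : ℕ} (hd : 1 ≤ d) (a : ℕ) {x : ℂ} (hx0 : x ≠ 0) (hx : ‖x‖ < 1) :
    Summable (fun k => ‖gapTerm d a x k‖) :=
  (summable_gapTerm hd a (norm_pos_iff.2 hx0) hx).of_nonneg_of_le (fun _ => norm_nonneg _)
    (norm_gapTerm_le d a hx)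

/-- The generating function of `qPart d a` is the sum over the number of parts. -/
theorem hasSum_qPart_complex {d a : ℕ} (hd : 1 ≤ d) (ha : 1 ≤ a) {x : ℂ} (hx0 : x ≠ 0)
    (hx : ‖x‖ < 1) :
    HasSum (fun n => (qPart d a n : ℂ) * x ^ n) (∑' k, gapTerm d a x k) := by
  have hs : Summable (fun l : {l : List ℕ // GapList d a l} => x ^ l.1.sum) := by
    refine Summable.of_norm ?_
    simpa only [norm_pow] using summable_gapList hd a (norm_pos_iff.2 hx0) hx
  have h1 : HasSum (fun l : {l : List ℕ // GapList d a l} => x ^ l.1.sum)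
      (∑' k, gapTerm d a x k) := by
    rw [← (gapListLengthEquiv d a).hasSum_iff]
    refine (summable_norm_gapTerm hd a hx0 hx).of_norm.hasSum.sigma_of_hasSum
      (fun k => hasSum_gapList_complex d hx k a) ?_
    exact (gapListLengthEquiv d a).summable_iff.2 hs
  rw [← (gapListSumEquiv d a).hasSum_iff] at h1
  refine h1.sigma fun n => ?_
  have := finite_gapList d a n hd ha
  have := Fintype.ofFinite {l : List ℕ // GapList d a l ∧ l.sum = n}
  convert hasSum_fintype _
  rw [Finset.sum_congr rfl (g := fun _ => x ^ n) (fun l _ => ?_)]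
  · rw [qPart_eq_card d a n hd ha, Finset.sum_const, Finset.card_univ, Nat.card_eq_fintype_card,
      nsmul_eq_mul]
  · simp [gapListSumEquiv, l.2.2]

theorem gapTerm_ofReal (d a : ℕ) (r : ℝ) (k : ℕ) :
    gapTerm d a (r : ℂ) k = ((gapTerm d a r k : ℝ) : ℂ) := by
  simp [gapTerm]

theorem hasSum_qPart_real {d a : ℕ} (hd : 1 ≤ d) (ha : 1 ≤ a) {r : ℝ} (hr : 0 < r)
    (hr1 : r < 1) :
    HasSum (fun n => (qPart d a n : ℝ) * r ^ n) (∑' k, gapTerm d a r k) := by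
  have := hasSum_qPart_complex hd ha (x := (r : ℂ)) (by exact_mod_cast hr.ne')
    (by rwa [Complex.norm_real, Real.norm_of_nonneg hr.le])
  simp_rw [gapTerm_ofReal] at this
  rw [← Complex.ofReal_tsum] at this
  exact_mod_cast this

/-- The dilogarithm series. -/
noncomputable def dilog (y : ℝ) : ℝ := ∑' r : ℕ, y ^ (r + 1) / ((r : ℝ) + 1) ^ 2

theorem summable_one_div_succ_sq : Summable fun r : ℕ => 1 / ((r : ℝ) + 1) ^ 2 := by
  have := (summable_nat_add_iff 1).2 (Real.summable_one_div_nat_pow.2 one_lt_two)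
  simpa using this

theorem norm_dilog_term_le {y : ℝ} (hy : |y| ≤ 1) (r : ℕ) :
    ‖y ^ (r + 1) / ((r : ℝ) + 1) ^ 2‖ ≤ 1 / ((r : ℝ) + 1) ^ 2 := by
  rw [norm_div, norm_pow, norm_pow, Real.norm_eq_abs, Real.norm_of_nonneg (by positivity)]
  gcongr
  exact pow_le_one₀ (abs_nonneg _) hy

theorem continuousOn_dilog : ContinuousOn dilog (Set.Icc (-1) 1) := by
  refine continuousOn_tsum (fun r => by fun_prop) summable_one_div_succ_sq fun r y hy => ?_
  exact norm_dilog_term_le (abs_le.2 hy) r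

theorem hasDerivAt_dilog {y : ℝ} (hy0 : 0 < y) (hy1 : y < 1) :
    HasDerivAt dilog (-log (1 - y) / y) y := by
  obtain ⟨c, hyc, hc1⟩ := exists_between hy1
  have hc0 : 0 < c := hy0.trans hyc
  have h := hasDerivAt_tsum_of_isPreconnected (u := fun r : ℕ => c ^ r)
    (g := fun (r : ℕ) (z : ℝ) => z ^ (r + 1) / ((r : ℝ) + 1) ^ 2)
    (g' := fun (r : ℕ) (z : ℝ) => z ^ r / ((r : ℝ) + 1)) (t := Set.Ioo (-c) c) (y₀ := y) (y := y)
    (summable_geometric_of_lt_one hc0.le hc1) isOpen_Ioo isPreconnected_Ioo ?_ ?_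
    ⟨by linarith, hyc⟩ ?_ ⟨by linarith, hyc⟩
  · refine h.congr_deriv ?_
    have h2 := (Real.hasSum_pow_div_log_of_abs_lt_one (x := y)
      (abs_lt.2 ⟨by linarith, hy1⟩)).div_const y
    rw [← h2.tsum_eq]
    congr 1
    funext r
    rw [pow_succ]
    field_simp
  · intro r z _
    have := (hasDerivAt_pow (r + 1) z).div_const (((r : ℝ) + 1) ^ 2)
    refine this.congr_deriv ?_
    push_cast
    have : (r : ℝ) + 1 ≠ 0 := by positivity
    field_simp
  · intro r z hz
    have hz' : |z| ≤ c := abs_le.2 ⟨hz.1.le, hz.2.le⟩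
    rw [norm_div, norm_pow, Real.norm_eq_abs, Real.norm_of_nonneg (by positivity)]
    calc |z| ^ r / ((r : ℝ) + 1) ≤ |z| ^ r :=
          div_le_self (by positivity) (by linarith [r.cast_nonneg (α := ℝ)])
      _ ≤ c ^ r := by gcongr
  · exact Summable.of_norm_bounded summable_one_div_succ_sq
      fun r => norm_dilog_term_le (abs_le.2 ⟨by linarith, hy1.le⟩) r

theorem one_sub_exp_neg_pos {u : ℝ} (hu : 0 < u) : 0 < 1 - exp (-u) :=
  sub_pos.2 (exp_lt_one_iff.2 (by linarith))

/-- The primitive of `u ↦ log (1 - exp (-u))` vanishing at zero. -/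
noncomputable def logPrimitive (u : ℝ) : ℝ := u * log (1 - exp (-u)) - dilog (1 - exp (-u))

theorem hasDerivAt_one_sub_exp_neg (u : ℝ) :
    HasDerivAt (fun u : ℝ => 1 - exp (-u)) (exp (-u)) u := by
  have := ((hasDerivAt_neg u).exp).const_sub 1
  simpa using this

theorem hasDerivAt_logPrimitive {u : ℝ} (hu : 0 < u) :
    HasDerivAt logPrimitive (log (1 - exp (-u))) u := by
  have h0 := one_sub_exp_neg_pos hu
  have h1 := hasDerivAt_one_sub_exp_neg u
  have h2 := hasDerivAt_dilog h0 (by linarith [exp_pos (-u)])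
  have h3 := ((hasDerivAt_id u).mul (h1.log h0.ne')).sub (h2.comp u h1)
  refine h3.congr_deriv ?_
  simp only [id, sub_sub_cancel, log_exp]
  field_simp
  ring

/-- The logarithm of `(1 - exp (-x)) / x`, continuous at zero. -/
noncomputable def logRatio (x : ℝ) : ℝ := log ((1 - exp (-x)) / x)

/-- The derivative of `logRatio` on `[0, ∞)`. -/
noncomputable def logRatioDeriv (x : ℝ) : ℝ := if x = 0 then -1 / 2 else 1 / (exp x - 1) - 1 / x

/-- The primitive of `logRatio` vanishing at zero. -/
noncomputable def logRatioPrimitive (x : ℝ) : ℝ := logPrimitive x - x * log x + x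

theorem hasDerivAt_logRatio {x : ℝ} (hx : 0 < x) : HasDerivAt logRatio (logRatioDeriv x) x := by
  have h0 := one_sub_exp_neg_pos hx
  have h1 := ((hasDerivAt_one_sub_exp_neg x).div (hasDerivAt_id x) hx.ne').log
    (div_pos h0 hx).ne'
  refine h1.congr_deriv ?_
  rw [logRatioDeriv, if_neg hx.ne']
  have h2 : exp x - 1 ≠ 0 := by
    have := add_one_lt_exp hx.ne'
    linarith
  have h3 : 1 - exp (-x) = exp (-x) * (exp x - 1) := by
    rw [mul_sub, ← exp_add]; simp
  simp only [Pi.div_apply, id, mul_one, h3]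
  have h4 := (exp_pos (-x)).ne'
  field_simp

theorem hasDerivAt_logRatioPrimitive {x : ℝ} (hx : 0 < x) :
    HasDerivAt logRatioPrimitive (logRatio x) x := by
  have h1 := ((hasDerivAt_logPrimitive hx).sub (hasDerivAt_mul_log hx.ne')).add (hasDerivAt_id x)
  refine h1.congr_deriv ?_
  rw [logRatio, log_div (one_sub_exp_neg_pos hx).ne' hx.ne']
  ring

theorem continuousWithinAt_logRatio_zero : ContinuousWithinAt logRatio (Set.Ici 0) 0 := by
  have h1 := (hasDerivAt_one_sub_exp_neg 0).tendsto_slope_zero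
  simp only [zero_add, neg_zero, exp_zero, sub_self, sub_zero, smul_eq_mul] at h1
  have h2 := (h1.mono_left (nhdsGT_le_nhdsNE 0)).log one_ne_zero
  rw [log_one] at h2
  rw [← continuousWithinAt_Ioi_iff_Ici, ContinuousWithinAt]
  have h0 : logRatio 0 = 0 := by simp [logRatio]
  rw [h0]
  refine h2.congr fun x => ?_
  rw [logRatio, div_eq_inv_mul]

theorem continuousOn_logRatio : ContinuousOn logRatio (Set.Ici 0) := by
  intro x hx
  rcases eq_or_lt_of_le (Set.mem_Ici.1 hx) with rfl | hx
  · exact continuousWithinAt_logRatio_zero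
  · exact (hasDerivAt_logRatio hx).continuousAt.continuousWithinAt

theorem logRatioPrimitive_eq {x : ℝ} (hx : 0 ≤ x) :
    logRatioPrimitive x = x * logRatio x + x - dilog (1 - exp (-x)) := by
  rcases eq_or_lt_of_le hx with rfl | hx
  · simp [logRatioPrimitive, logPrimitive]
  · rw [logRatioPrimitive, logPrimitive, logRatio, log_div (one_sub_exp_neg_pos hx).ne' hx.ne']
    ring

theorem logRatioPrimitive_zero : logRatioPrimitive 0 = 0 := by
  simp [logRatioPrimitive, logPrimitive, dilog]

theorem continuousOn_logRatioPrimitive : ContinuousOn logRatioPrimitive (Set.Ici 0) := by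
  refine ContinuousOn.congr ?_ fun x hx => logRatioPrimitive_eq hx
  refine ((continuousOn_id.mul continuousOn_logRatio).add continuousOn_id).sub ?_
  refine continuousOn_dilog.comp (by fun_prop) fun x hx => ?_
  have h1 : exp (-x) ≤ 1 := exp_le_one_iff.2 (by simpa using hx)
  have h2 := exp_pos (-x)
  exact ⟨by linarith, by linarith⟩

theorem neg_half_le_logRatioDeriv {x : ℝ} (hx : 0 < x) : -1 / 2 ≤ 1 / (exp x - 1) - 1 / x := by
  have h2 : 0 < exp x - 1 := by
    have := add_one_lt_exp hx.ne'
    linarith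
  have hmono : MonotoneOn (fun y : ℝ => y * (exp y + 1) - 2 * (exp y - 1)) (Set.Ici 0) := by
    have hder : ∀ y : ℝ, HasDerivAt (fun y : ℝ => y * (exp y + 1) - 2 * (exp y - 1))
        (1 + (y - 1) * exp y) y := by
      intro y
      have := ((hasDerivAt_id y).mul ((Real.hasDerivAt_exp y).add_const 1)).sub
        (((Real.hasDerivAt_exp y).sub_const 1).const_mul 2)
      refine this.congr_deriv ?_
      simp only [id]; ring
    refine monotoneOn_of_deriv_nonneg (convex_Ici 0)
      (fun y _ => (hder y).continuousAt.continuousWithinAt)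
      (fun y _ => (hder y).differentiableAt.differentiableWithinAt) fun y _ => ?_
    rw [(hder y).deriv]
    have h3 := add_one_le_exp (-y)
    have h4 : exp (-y) * exp y = 1 := by rw [← exp_add]; simp
    nlinarith [exp_pos y]
  have h := hmono (Set.mem_Ici.2 le_rfl) (Set.mem_Ici.2 hx.le) hx.le
  simp only [exp_zero, sub_self, mul_zero, zero_mul] at h
  rw [div_sub_div _ _ h2.ne' hx.ne', div_le_div_iff₀ two_pos (by positivity)]
  nlinarith

theorem monotoneOn_logRatioDeriv : MonotoneOn logRatioDeriv (Set.Ici 0) := by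
  have hder : ∀ y : ℝ, 0 < y → HasDerivAt (fun y : ℝ => 1 / (exp y - 1) - 1 / y)
      (1 / y ^ 2 - exp y / (exp y - 1) ^ 2) y := by
    intro y hy
    have h2 : exp y - 1 ≠ 0 := by
      have := add_one_lt_exp hy.ne'
      linarith
    have := (((Real.hasDerivAt_exp y).sub_const 1).inv h2).sub (hasDerivAt_inv hy.ne')
    simp only [one_div]
    refine this.congr_deriv ?_
    ring
  have hpos : MonotoneOn (fun y : ℝ => 1 / (exp y - 1) - 1 / y) (Set.Ioi 0) := by
    refine monotoneOn_of_deriv_nonneg (convex_Ioi 0)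
      (fun y hy => (hder y hy).continuousAt.continuousWithinAt) (fun y hy => ?_) fun y hy => ?_
    · rw [interior_Ioi] at hy
      exact (hder y hy).differentiableAt.differentiableWithinAt
    · rw [interior_Ioi] at hy
      have hy : 0 < y := hy
      rw [(hder y hy).deriv]
      have h2 : 0 < exp y - 1 := by
        have := add_one_lt_exp hy.ne'
        linarith
      rw [sub_nonneg, div_le_div_iff₀ (by positivity) (by positivity)]
      have h3 : y / 2 ≤ sinh (y / 2) := self_le_sinh_iff.2 (by positivity)
      rw [sinh_eq] at h3
      have h4 : exp (y / 2) * exp (y / 2) = exp y := by rw [← exp_add]; ring_nf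
      have h5 : exp (-(y / 2)) * exp (y / 2) = 1 := by rw [← exp_add]; simp
      have h6 : y * exp (y / 2) ≤ exp y - 1 := by
        nlinarith [exp_pos (y / 2)]
      calc exp y * y ^ 2 = (y * exp (y / 2)) ^ 2 := by rw [← h4]; ring
        _ ≤ (exp y - 1) ^ 2 := by gcongr
        _ = 1 * (exp y - 1) ^ 2 := by ring
  intro a ha b hb hab
  rcases eq_or_lt_of_le (Set.mem_Ici.1 ha) with rfl | ha
  · rcases eq_or_lt_of_le hab with rfl | hb
    · rfl
    · rw [logRatioDeriv, logRatioDeriv, if_pos rfl, if_neg hb.ne']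
      exact neg_half_le_logRatioDeriv hb
  · have hb := ha.trans_le hab
    rw [logRatioDeriv, logRatioDeriv, if_neg ha.ne', if_neg hb.ne']
    exact hpos ha hb hab

theorem logRatioDeriv_nonpos {x : ℝ} (hx : 0 ≤ x) : logRatioDeriv x ≤ 0 := by
  rw [logRatioDeriv]
  split_ifs with h
  · norm_num
  · have hx : 0 < x := lt_of_le_of_ne hx (Ne.symm h)
    have h2 := add_one_lt_exp hx.ne'
    rw [sub_nonpos]
    exact one_div_le_one_div_of_le hx (by linarith)

/-- Error of the trapezoidal rule when the derivative of the integrand is monotone. -/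
theorem abs_trapezoid_error_le {G g p : ℝ → ℝ} {a b : ℝ} (hab : a < b)
    (hG : ContinuousOn G (Set.Icc a b)) (hg : ContinuousOn g (Set.Icc a b))
    (hG' : ∀ y ∈ Set.Ioo a b, HasDerivAt G (g y) y) (hg' : ∀ y ∈ Set.Ioo a b, HasDerivAt g (p y) y)
    (hp : MonotoneOn p (Set.Icc a b)) :
    |G b - G a - (b - a) * (g a + g b) / 2| ≤ (b - a) ^ 2 / 2 * (p b - p a) := by
  have hbd : ∀ y ∈ Set.Ioc a b, g a + (y - a) * p a ≤ g y ∧ g y ≤ g a + (y - a) * p b := by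
    intro y hy
    obtain ⟨c, hc, hc'⟩ := exists_hasDerivAt_eq_slope g p hy.1
      (hg.mono (Set.Icc_subset_Icc_right hy.2)) fun z hz => hg' z ⟨hz.1, hz.2.trans_le hy.2⟩
    have hya : 0 < y - a := sub_pos.2 hy.1
    rw [eq_div_iff hya.ne'] at hc'
    have h1 := hp (Set.left_mem_Icc.2 hab.le) ⟨hc.1.le, hc.2.le.trans hy.2⟩ hc.1.le
    have h2 := hp ⟨hc.1.le, hc.2.le.trans hy.2⟩ (Set.right_mem_Icc.2 hab.le) (hc.2.le.trans hy.2)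
    constructor <;> nlinarith
  have hK : ∀ q : ℝ, ∃ c ∈ Set.Ioo a b, (g c - g a - (c - a) * q) * (b - a) =
      G b - G a - g a * (b - a) - (b - a) ^ 2 / 2 * q := by
    intro q
    obtain ⟨c, hc, hc'⟩ := exists_hasDerivAt_eq_slope
      (fun y => G y - g a * (y - a) - (y - a) ^ 2 / 2 * q) (fun y => g y - g a - (y - a) * q) hab
      ((hG.sub (by fun_prop)).sub (by fun_prop)) fun y hy => by
        have h1 := (hasDerivAt_id y).sub_const a
        have := ((hG' y hy).sub (h1.const_mul (g a))).sub (((h1.pow 2).div_const 2).mul_const q)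
        refine this.congr_deriv ?_
        simp
    refine ⟨c, hc, ?_⟩
    rw [hc', div_mul_cancel₀ _ (sub_pos.2 hab).ne']
    ring
  obtain ⟨c, hc, hc'⟩ := hK (p a)
  obtain ⟨e, he, he'⟩ := hK (p b)
  have h1 := (hbd c ⟨hc.1, hc.2.le⟩).1
  have h2 := (hbd e ⟨he.1, he.2.le⟩).2
  have h3 := hbd b ⟨hab, le_rfl⟩
  have hba := sub_pos.2 hab
  have h4 : 0 ≤ (g c - g a - (c - a) * p a) * (b - a) := mul_nonneg (by linarith) hba.le
  have h5 : (g e - g a - (e - a) * p b) * (b - a) ≤ 0 :=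
    mul_nonpos_of_nonpos_of_nonneg (by linarith) hba.le
  rw [hc'] at h4
  rw [he'] at h5
  have h6 := mul_le_mul_of_nonneg_left h3.1 hba.le
  have h7 := mul_le_mul_of_nonneg_left h3.2 hba.le
  rw [abs_le]
  constructor <;> nlinarith

theorem abs_sum_logRatio_sub_le {t : ℝ} (ht : 0 < t) (k : ℕ) :
    |∑ j ∈ Finset.range k, logRatio (((j + 1 : ℕ) : ℝ) * t) - logRatioPrimitive (k * t) / t -
      logRatio (k * t) / 2| ≤ t / 4 := by
  have key : |∑ j ∈ Finset.range k, logRatio (((j + 1 : ℕ) : ℝ) * t) -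
      logRatioPrimitive (k * t) / t - logRatio (k * t) / 2| ≤
        t / 2 * (logRatioDeriv (k * t) + 1 / 2) := by
    induction k with
    | zero => simp [logRatioPrimitive_zero, logRatio, logRatioDeriv]; norm_num
    | succ k ih =>
      have hk : (0 : ℝ) ≤ k * t := by positivity
      have hlt : (k : ℝ) * t < (k + 1 : ℕ) * t := by push_cast; nlinarith
      have hsub : Set.Icc (k * t : ℝ) ((k + 1 : ℕ) * t) ⊆ Set.Ici 0 := fun y hy => hk.trans hy.1
      have h := abs_trapezoid_error_le hlt (continuousOn_logRatioPrimitive.mono hsub)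
        (continuousOn_logRatio.mono hsub)
        (fun y hy => hasDerivAt_logRatioPrimitive (hk.trans_lt hy.1))
        (fun y hy => hasDerivAt_logRatio (hk.trans_lt hy.1)) (monotoneOn_logRatioDeriv.mono hsub)
      have hd : ((k + 1 : ℕ) : ℝ) * t - k * t = t := by push_cast; ring
      rw [hd] at h
      rw [Finset.sum_range_succ]
      set a := logRatioPrimitive (k * t)
      set b := logRatioPrimitive ((k + 1 : ℕ) * t)
      set x := logRatio (k * t)
      set y := logRatio ((k + 1 : ℕ) * t)
      set p := logRatioDeriv (k * t)
      set q := logRatioDeriv ((k + 1 : ℕ) * t)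
      set S := ∑ j ∈ Finset.range k, logRatio (((j + 1 : ℕ) : ℝ) * t)
      have e1 : S + y - b / t - y / 2 = (S - a / t - x / 2) - (b - a - t * (x + y) / 2) / t := by
        field_simp; ring
      rw [e1]
      refine (abs_sub _ _).trans ?_
      rw [abs_div, abs_of_pos ht]
      have h2 : |b - a - t * (x + y) / 2| / t ≤ t / 2 * (q - p) := by
        rw [div_le_iff₀ ht]
        refine h.trans (le_of_eq ?_)
        ring
      linarith
  refine key.trans ?_
  have := logRatioDeriv_nonpos (x := k * t) (by positivity)
  nlinarith

theorem prod_one_sub_exp_eq {t : ℝ} (ht : 0 < t) (k : ℕ) :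
    ∏ j ∈ Finset.range k, (1 - exp (-t) ^ (j + 1)) =
      (k.factorial : ℝ) * t ^ k * exp (∑ j ∈ Finset.range k, logRatio (((j + 1 : ℕ) : ℝ) * t)) := by
  induction k with
  | zero => simp
  | succ k ih =>
    have h1 : (0 : ℝ) < ((k + 1 : ℕ) : ℝ) * t := by positivity
    rw [Finset.prod_range_succ, ih, Finset.sum_range_succ, exp_add, logRatio,
      exp_log (div_pos (one_sub_exp_neg_pos h1) h1), ← exp_nat_mul, Nat.factorial_succ, mul_neg]
    generalize ∑ j ∈ Finset.range k, logRatio (((j + 1 : ℕ) : ℝ) * t) = S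
    rw [Nat.cast_mul, pow_succ]
    field_simp

theorem prod_one_sub_exp_eq_stirling {t : ℝ} (ht : 0 < t) {k : ℕ} (hk : 0 < k) :
    (∏ j ∈ Finset.range k, (1 - exp (-t) ^ (j + 1))) * √t * exp (-logPrimitive (k * t) / t) =
      Stirling.stirlingSeq k * √(2 * (k * t)) * exp (logRatio (k * t) / 2) *
        exp (∑ j ∈ Finset.range k, logRatio (((j + 1 : ℕ) : ℝ) * t) -
          logRatioPrimitive (k * t) / t - logRatio (k * t) / 2) := by
  have hk' : (0 : ℝ) < k := by exact_mod_cast hk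
  rw [prod_one_sub_exp_eq ht, Stirling.stirlingSeq, ← mul_assoc 2 (k : ℝ) t,
    Real.sqrt_mul (by positivity) t]
  set S := ∑ j ∈ Finset.range k, logRatio (((j + 1 : ℕ) : ℝ) * t)
  have h1 : exp S * exp (-logPrimitive (k * t) / t) = exp (logRatio (k * t) / 2) *
      exp (S - logRatioPrimitive (k * t) / t - logRatio (k * t) / 2) *
        (((k : ℝ) * t) ^ k / exp 1 ^ k)⁻¹ := by
    have h2 : ((k : ℝ) * t) ^ k / exp 1 ^ k = exp (k * log (k * t) - k) := by
      rw [exp_sub, mul_comm (k : ℝ) (log _), ← Real.rpow_def_of_pos (by positivity),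
        Real.rpow_natCast, ← exp_nat_mul, mul_one]
    rw [h2, ← exp_neg, ← exp_add, ← exp_add, ← exp_add, logRatioPrimitive]
    congr 1
    field_simp
    ring
  have h3 : √(2 * (k : ℝ)) ≠ 0 := by positivity
  calc (k.factorial : ℝ) * t ^ k * exp S * √t * exp (-logPrimitive (k * t) / t) =
      (k.factorial : ℝ) * t ^ k * √t * (exp S * exp (-logPrimitive (k * t) / t)) := by ring
    _ = _ := by
      rw [h1, mul_pow, div_pow]
      have := exp_pos 1
      field_simp

/-- Asymptotics of the finite `q`-Pochhammer product. -/
theorem tendsto_prod_one_sub_exp {u : ℝ} (hu : 0 < u) {k : ℝ → ℕ}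
    (hk : Tendsto (fun t => k t * t) (nhdsWithin 0 (Set.Ioi 0)) (nhds u)) :
    Tendsto (fun t => (∏ j ∈ Finset.range (k t), (1 - exp (-t) ^ (j + 1))) * √t *
      exp (-logPrimitive (k t * t) / t)) (nhdsWithin 0 (Set.Ioi 0))
      (nhds √(2 * π * (1 - exp (-u)))) := by
  have hkpos : ∀ᶠ t in nhdsWithin (0 : ℝ) (Set.Ioi 0), 0 < k t := by
    filter_upwards [hk.eventually (lt_mem_nhds hu)] with t h
    rcases Nat.eq_zero_or_pos (k t) with h0 | h0
    · simp [h0] at h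
    · exact h0
  have hktop : Tendsto k (nhdsWithin 0 (Set.Ioi 0)) atTop := by
    rw [← tendsto_natCast_atTop_iff (R := ℝ)]
    refine (hk.pos_mul_atTop hu tendsto_inv_nhdsGT_zero).congr' ?_
    filter_upwards [self_mem_nhdsWithin] with t ht
    have ht : (0 : ℝ) < t := ht
    field_simp
  have h1 := Stirling.tendsto_stirlingSeq_sqrt_pi.comp hktop
  have h2 : Tendsto (fun t => √(2 * (k t * t))) (nhdsWithin 0 (Set.Ioi 0)) (nhds √(2 * u)) :=
    (hk.const_mul 2).sqrt
  have h3 : Tendsto (fun t => exp (logRatio (k t * t) / 2)) (nhdsWithin 0 (Set.Ioi 0))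
      (nhds (exp (logRatio u / 2))) :=
    ((((hasDerivAt_logRatio hu).continuousAt.tendsto.comp hk)).div_const 2).rexp
  have h4 : Tendsto (fun t => exp (∑ j ∈ Finset.range (k t), logRatio (((j + 1 : ℕ) : ℝ) * t) -
      logRatioPrimitive (k t * t) / t - logRatio (k t * t) / 2)) (nhdsWithin 0 (Set.Ioi 0))
      (nhds (exp 0)) := by
    refine Tendsto.rexp (squeeze_zero_norm' (a := fun t : ℝ => t / 4) ?_ ?_)
    · filter_upwards [self_mem_nhdsWithin] with t ht
      exact abs_sum_logRatio_sub_le ht (k t)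
    · have : Tendsto (fun t : ℝ => t / 4) (nhds 0) (nhds (0 / 4)) := tendsto_id.div_const 4
      rw [zero_div] at this
      exact this.mono_left nhdsWithin_le_nhds
  have h5 := ((h1.mul h2).mul h3).mul h4
  have h6 : √π * √(2 * u) * exp (logRatio u / 2) * exp 0 = √(2 * π * (1 - exp (-u))) := by
    have h7 : exp (logRatio u / 2) = √((1 - exp (-u)) / u) := by
      rw [logRatio, Real.exp_half, exp_log (div_pos (one_sub_exp_neg_pos hu) hu)]
    rw [h7, exp_zero, mul_one, ← Real.sqrt_mul pi_pos.le, ← Real.sqrt_mul (by positivity)]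
    congr 1
    field_simp
  rw [h6] at h5
  refine h5.congr' ?_
  filter_upwards [self_mem_nhdsWithin, hkpos] with t ht hkt
  exact (prod_one_sub_exp_eq_stirling ht hkt).symm

theorem tendsto_sqrt_nhdsGT_zero :
    Tendsto (fun t : ℝ => √t) (nhdsWithin 0 (Set.Ioi 0)) (nhds 0) := by
  have := (Real.continuous_sqrt.tendsto 0).mono_left (nhdsWithin_le_nhds (s := Set.Ioi 0))
  simpa using this

theorem exp_neg_pos_lt_one {t : ℝ} (ht : 0 < t) : 0 < exp (-t) ∧ exp (-t) < 1 :=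
  ⟨exp_pos _, exp_lt_one_iff.2 (by linarith)⟩

theorem gapTerm_exp_succ (d a : ℕ) {t : ℝ} (ht : 0 < t) (k : ℕ) :
    gapTerm d a (exp (-t)) (k + 1) = gapTerm d a (exp (-t)) k *
      exp (-(a + d * k) * t - log (1 - exp (-((k + 1 : ℕ) * t)))) := by
  have h1 : (0 : ℝ) < (k + 1 : ℕ) * t := by positivity
  rw [gapTerm_succ_eq_mul, exp_sub, exp_log (one_sub_exp_neg_pos h1), ← exp_nat_mul,
    ← exp_nat_mul, mul_neg, mul_neg]
  push_cast
  ring_nf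

theorem log_one_sub_exp_neg_mono {x y : ℝ} (hx : 0 < x) (hxy : x ≤ y) :
    log (1 - exp (-x)) ≤ log (1 - exp (-y)) :=
  log_le_log (one_sub_exp_neg_pos hx) (by linarith [exp_le_exp.2 (neg_le_neg hxy)])

theorem gapTerm_add_le {d a : ℕ} {u t : ℝ} (hu : 0 < u) (hu' : log (1 - exp (-u)) = -(d * u))
    (ht : 0 < t) {K : ℕ} (hK : u ≤ (K + 1) * t) (m : ℕ) :
    gapTerm d a (exp (-t)) (K + m) ≤ gapTerm d a (exp (-t)) K *
      exp (-(d / 2 * t * m ^ 2) + (2 * d + a) * t * m) := by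
  induction m with
  | zero => simp
  | succ m ih =>
    have hpos := exp_neg_pos_lt_one ht
    rw [← add_assoc, gapTerm_exp_succ d a ht]
    have h1 : u ≤ ((K + m + 1 : ℕ) : ℝ) * t := by
      push_cast
      nlinarith [mul_nonneg (m.cast_nonneg (α := ℝ)) ht.le]
    have h2 := log_one_sub_exp_neg_mono hu h1
    rw [hu'] at h2
    have hd0 : (0 : ℝ) ≤ d := d.cast_nonneg
    have ha0 : (0 : ℝ) ≤ a := a.cast_nonneg
    calc gapTerm d a (exp (-t)) (K + m) *
          exp (-(a + d * (K + m : ℕ)) * t - log (1 - exp (-((K + m + 1 : ℕ) * t))))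
        ≤ (gapTerm d a (exp (-t)) K * exp (-(d / 2 * t * m ^ 2) + (2 * d + a) * t * m)) *
          exp (-(a + d * (K + m : ℕ)) * t - log (1 - exp (-((K + m + 1 : ℕ) * t)))) := by
          gcongr
      _ = gapTerm d a (exp (-t)) K * exp (-(d / 2 * t * m ^ 2) + (2 * d + a) * t * m +
          (-(a + d * (K + m : ℕ)) * t - log (1 - exp (-((K + m + 1 : ℕ) * t))))) := by
          rw [mul_assoc, ← exp_add]
      _ ≤ _ := by
          refine mul_le_mul_of_nonneg_left (exp_le_exp.2 ?_) (gapTerm_pos d a hpos.1 hpos.2 K).le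
          push_cast at h2 ⊢
          have h3 := mul_le_mul_of_nonneg_left hK hd0
          nlinarith [mul_nonneg hd0 ht.le, mul_nonneg ha0 ht.le]

theorem gapTerm_le_of_add_eq {d a : ℕ} {u t : ℝ} (hu' : log (1 - exp (-u)) = -(d * u))
    (ht : 0 < t) {K : ℕ} (hK : K * t ≤ u) (m : ℕ) : ∀ k, k + m = K →
    gapTerm d a (exp (-t)) k ≤ gapTerm d a (exp (-t)) K *
      exp (-(d / 2 * t * m ^ 2) + (2 * d + a) * t * m) := by
  induction m with
  | zero => rintro k rfl; simp
  | succ m ih =>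
    intro k hk
    have hpos := exp_neg_pos_lt_one ht
    have hk1 := ih (k + 1) (by omega)
    rw [gapTerm_exp_succ d a ht] at hk1
    have hKr : (K : ℝ) = k + (m + 1) := by exact_mod_cast hk.symm
    have h0 : (0 : ℝ) < (k + 1 : ℕ) * t := by positivity
    have h1 : ((k + 1 : ℕ) : ℝ) * t ≤ u := by
      push_cast
      nlinarith [mul_nonneg (m.cast_nonneg (α := ℝ)) ht.le]
    have h2 := log_one_sub_exp_neg_mono h0 h1
    rw [hu'] at h2
    have hd0 : (0 : ℝ) ≤ d := d.cast_nonneg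
    have ha0 : (0 : ℝ) ≤ a := a.cast_nonneg
    rw [← le_div_iff₀ (exp_pos _), mul_div_assoc, ← exp_sub] at hk1
    refine hk1.trans (mul_le_mul_of_nonneg_left (exp_le_exp.2 ?_)
      (gapTerm_pos d a hpos.1 hpos.2 K).le)
    push_cast at h2 ⊢
    have h3 := mul_le_mul_of_nonneg_left hK hd0
    rw [hKr] at h3
    nlinarith [mul_nonneg hd0 ht.le, mul_nonneg ha0 ht.le]

/-- Gaussian domination of the terms by the one at `⌊u / t⌋₊`. -/
theorem gapTerm_le_gaussian {d a : ℕ} {u t : ℝ} (hu : 0 < u)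
    (hu' : log (1 - exp (-u)) = -(d * u)) (ht : 0 < t) (k : ℕ) :
    gapTerm d a (exp (-t)) k ≤ gapTerm d a (exp (-t)) ⌊u / t⌋₊ *
      exp (-(d / 2 * t * ((k : ℝ) - ⌊u / t⌋₊) ^ 2) +
        (2 * d + a) * t * |(k : ℝ) - ⌊u / t⌋₊|) := by
  have hK1 : (⌊u / t⌋₊ : ℝ) * t ≤ u := by
    rw [← le_div_iff₀ ht]; exact Nat.floor_le (by positivity)
  have hK2 : u ≤ ((⌊u / t⌋₊ : ℝ) + 1) * t := by
    rw [← div_le_iff₀ ht]; exact (Nat.lt_floor_add_one _).le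
  generalize ⌊u / t⌋₊ = K at *
  rcases le_total K k with h | h
  · obtain ⟨m, rfl⟩ := Nat.exists_eq_add_of_le h
    have := gapTerm_add_le (a := a) hu hu' ht hK2 m
    simpa [abs_of_nonneg] using this
  · obtain ⟨m, rfl⟩ := Nat.exists_eq_add_of_le h
    have := gapTerm_le_of_add_eq (a := a) hu' ht hK1 m k rfl
    have e : (k : ℝ) - (k + m : ℕ) = -m := by push_cast; ring
    rw [e, abs_neg, neg_sq, Nat.abs_cast]
    exact this

/-- The exponential rate function of the terms. -/
noncomputable def gapRate (d : ℕ) (v : ℝ) : ℝ := d / 2 * v ^ 2 + logPrimitive v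

theorem hasDerivAt_gapRate (d : ℕ) {v : ℝ} (hv : 0 < v) :
    HasDerivAt (gapRate d) (d * v + log (1 - exp (-v))) v := by
  have := (((hasDerivAt_id v).pow 2).const_mul ((d : ℝ) / 2)).add (hasDerivAt_logPrimitive hv)
  refine this.congr_deriv ?_
  simp only [id]
  ring

theorem tendsto_gapRate_slope {d : ℕ} {u : ℝ} (hu : 0 < u)
    (hu' : log (1 - exp (-u)) = -(d * u)) :
    Tendsto (fun v => (gapRate d v - gapRate d u) / (v - u) ^ 2) (nhdsWithin u {u}ᶜ)
      (nhds ((d + exp (-u) / (1 - exp (-u))) / 2)) := by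
  have hpos : ∀ᶠ v in nhdsWithin u {u}ᶜ, 0 < v :=
    (lt_mem_nhds hu).filter_mono nhdsWithin_le_nhds
  have hcont : ContinuousAt (fun v => gapRate d v - gapRate d u) u :=
    ((hasDerivAt_gapRate d hu).continuousAt).sub continuousAt_const
  have hcont2 : ContinuousAt (fun v => (v - u) ^ 2) u := by fun_prop
  refine HasDerivAt.lhopital_zero_nhdsNE (f' := fun v => d * v + log (1 - exp (-v)))
    (g' := fun v => 2 * (v - u)) ?_ ?_ ?_ ?_ ?_ ?_
  · filter_upwards [hpos] with v hv
    exact (hasDerivAt_gapRate d hv).sub_const _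
  · refine Eventually.of_forall fun v => ?_
    have := ((hasDerivAt_id v).sub_const u).pow 2
    refine this.congr_deriv ?_
    simp
  · filter_upwards [self_mem_nhdsWithin] with v hv
    exact mul_ne_zero two_ne_zero (sub_ne_zero.2 hv)
  · have := hcont.tendsto
    rw [sub_self] at this
    exact this.mono_left nhdsWithin_le_nhds
  · have := hcont2.tendsto
    rw [sub_self, zero_pow two_ne_zero] at this
    exact this.mono_left nhdsWithin_le_nhds
  · have h1 : HasDerivAt (fun v => d * v + log (1 - exp (-v)))
        (d + exp (-u) / (1 - exp (-u))) u := by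
      have := ((hasDerivAt_id u).const_mul (d : ℝ)).add
        ((hasDerivAt_one_sub_exp_neg u).log (one_sub_exp_neg_pos hu).ne')
      refine this.congr_deriv ?_
      simp
    have h2 := (hasDerivAt_iff_tendsto_slope.1 h1).div_const 2
    refine h2.congr fun v => ?_
    rw [slope_def_field, hu']
    rw [div_div, mul_comm (v - u) 2]
    congr 1
    ring

theorem gapTerm_exp_eq (d a : ℕ) {t : ℝ} (ht : 0 < t) (k : ℕ) (A : ℝ) :
    gapTerm d a (exp (-t)) k * exp (-A / t) / √t =
      ((∏ j ∈ Finset.range k, (1 - exp (-t) ^ (j + 1))) * √t *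
        exp (-logPrimitive (k * t) / t))⁻¹ *
      exp (-((gapRate d (k * t) + A) / t) + (d / 2 - a) * (k * t)) := by
  have hP := prod_one_sub_pow_pos (exp_pos (-t)).le (exp_neg_pos_lt_one ht).2 k
  rw [gapTerm]
  generalize ∏ j ∈ Finset.range k, (1 - exp (-t) ^ (j + 1)) = P at *
  have h1 : exp (-t) ^ (a * k + d * k.choose 2) * exp (-A / t) *
      exp (-logPrimitive (k * t) / t) =
        exp (-((gapRate d (k * t) + A) / t) + (d / 2 - a) * (k * t)) := by
    rw [← exp_nat_mul, ← exp_add, ← exp_add, gapRate]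
    congr 1
    push_cast
    rw [Nat.cast_choose_two]
    field_simp
    ring
  rw [← h1]
  have h2 := Real.sqrt_pos.2 ht
  have h3 := exp_pos (-logPrimitive (k * t) / t)
  field_simp

theorem tendsto_gapTerm {d a : ℕ} {u : ℝ} (hu : 0 < u)
    (hu' : log (1 - exp (-u)) = -(d * u)) {s : ℝ} {k : ℝ → ℕ}
    (hk : Tendsto (fun t => (k t * t - u) / √t) (nhdsWithin 0 (Set.Ioi 0)) (nhds s)) :
    Tendsto (fun t => gapTerm d a (exp (-t)) (k t) * exp (gapRate d u / t) / √t)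
      (nhdsWithin 0 (Set.Ioi 0))
      (nhds ((√(2 * π * (1 - exp (-u))))⁻¹ * exp ((d / 2 - a) * u) *
        exp (-((d + exp (-u) / (1 - exp (-u))) / 2) * s ^ 2))) := by
  have hku : Tendsto (fun t => k t * t) (nhdsWithin 0 (Set.Ioi 0)) (nhds u) := by
    have := (hk.mul tendsto_sqrt_nhdsGT_zero).add_const u
    rw [mul_zero, zero_add] at this
    refine this.congr' ?_
    filter_upwards [self_mem_nhdsWithin] with t ht
    have := Real.sqrt_pos.2 (Set.mem_Ioi.1 ht)
    field_simp
    ring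
  set h : ℝ → ℝ := Function.update (fun v => (gapRate d v - gapRate d u) / (v - u) ^ 2) u
    ((d + exp (-u) / (1 - exp (-u))) / 2) with hh
  have hcont : ContinuousAt h u := continuousAt_update_same.2 (tendsto_gapRate_slope hu hu')
  have hval : ∀ v, gapRate d v - gapRate d u = h v * (v - u) ^ 2 := by
    intro v
    by_cases hv : v = u
    · simp [hv]
    · rw [hh, Function.update_of_ne hv, div_mul_cancel₀]
      exact pow_ne_zero _ (sub_ne_zero.2 hv)
  have h1 := (hcont.tendsto.comp hku).mul (hk.pow 2)
  have hu2 : h u = (d + exp (-u) / (1 - exp (-u))) / 2 := by simp [hh]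
  rw [hu2] at h1
  have hS : √(2 * π * (1 - exp (-u))) ≠ 0 := by
    have := one_sub_exp_neg_pos hu
    positivity
  have h2 := ((tendsto_prod_one_sub_exp hu hku).inv₀ hS).mul
    ((h1.neg.add (hku.const_mul ((d : ℝ) / 2 - a))).rexp)
  rw [exp_add, mul_comm (exp (-_)), ← mul_assoc, ← neg_mul] at h2
  refine h2.congr' ?_
  filter_upwards [self_mem_nhdsWithin] with t ht
  have ht : 0 < t := ht
  have h3 := gapTerm_exp_eq d a ht (k t) (-gapRate d u)
  rw [neg_neg] at h3
  rw [h3, ← sub_eq_add_neg, hval]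
  congr 3
  simp only [Function.comp]
  rw [div_pow, Real.sq_sqrt ht.le, mul_div_assoc]

theorem integral_indicator_floor {f : ℕ → ℝ} (hf : ∀ n, 0 ≤ f n) (hs : Summable f) :
    ∫ x : ℝ, (Set.Ici (0 : ℝ)).indicator (fun x => f ⌊x⌋₊) x = ∑' n, f n := by
  have hmeas : Measurable fun x : ℝ => f ⌊x⌋₊ :=
    (measurable_of_countable f).comp Nat.measurable_floor
  have hunion : Set.Ici (0 : ℝ) = ⋃ n : ℕ, Set.Ico (n : ℝ) (n + 1) := by
    ext x
    simp only [Set.mem_Ici, Set.mem_iUnion, Set.mem_Ico]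
    constructor
    · exact fun hx => ⟨⌊x⌋₊, Nat.floor_le hx, Nat.lt_floor_add_one x⟩
    · rintro ⟨n, hn, -⟩
      exact n.cast_nonneg.trans hn
  have hdisj : Pairwise (Function.onFun Disjoint fun n : ℕ => Set.Ico (n : ℝ) (n + 1)) := by
    intro m n hmn
    rw [Function.onFun, Set.disjoint_left]
    rintro x ⟨h1, h2⟩ ⟨h3, h4⟩
    apply hmn
    have h5 : (m : ℝ) < n + 1 := by linarith
    have h6 : (n : ℝ) < m + 1 := by linarith
    norm_cast at h5 h6
    omega
  rw [MeasureTheory.integral_indicator measurableSet_Ici,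
    MeasureTheory.integral_eq_lintegral_of_nonneg_ae (Eventually.of_forall fun x => hf _)
      hmeas.aestronglyMeasurable, hunion,
    MeasureTheory.lintegral_iUnion (fun n => measurableSet_Ico) hdisj]
  have hpiece : ∀ n : ℕ, ∫⁻ x in Set.Ico (n : ℝ) (n + 1), ENNReal.ofReal (f ⌊x⌋₊) =
      ENNReal.ofReal (f n) := by
    intro n
    rw [MeasureTheory.setLIntegral_congr_fun (g := fun _ => ENNReal.ofReal (f n))
      measurableSet_Ico fun x hx => ?_]
    · simp
    · simp only
      rw [Nat.floor_eq_on_Ico n x hx]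
  simp_rw [hpiece]
  rw [← ENNReal.ofReal_tsum_of_nonneg hf hs, ENNReal.toReal_ofReal (tsum_nonneg hf)]

theorem tsum_eq_integral_rescaled {f : ℕ → ℝ} (hf : ∀ n, 0 ≤ f n) (hs : Summable f) (b : ℝ)
    {c : ℝ} (hc : 0 < c) :
    ∑' n, f n =
      ∫ s : ℝ, (Set.Ici (0 : ℝ)).indicator (fun x => f ⌊x⌋₊) (b + s / c) / c := by
  rw [← integral_indicator_floor hf hs, MeasureTheory.integral_div,
    MeasureTheory.Measure.integral_comp_div
      (fun x => (Set.Ici (0 : ℝ)).indicator (fun x => f ⌊x⌋₊) (b + x)) c,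
    MeasureTheory.integral_add_left_eq_self (fun x => (Set.Ici (0 : ℝ)).indicator
      (fun x => f ⌊x⌋₊) x) b, abs_of_pos hc, smul_eq_mul]
  field_simp

/-- The generating function of `qPart d a` at `exp (-t)`, as the sum of the `gapTerm`s. -/
noncomputable def gapSum (d a : ℕ) (t : ℝ) : ℝ := ∑' k, gapTerm d a (exp (-t)) k

theorem summable_gapTerm_exp {d : ℕ} (hd : 1 ≤ d) (a : ℕ) {t : ℝ} (ht : 0 < t) :
    Summable (gapTerm d a (exp (-t))) :=
  summable_gapTerm hd a (exp_neg_pos_lt_one ht).1 (exp_neg_pos_lt_one ht).2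

theorem gapTerm_exp_pos (d a : ℕ) {t : ℝ} (ht : 0 < t) (k : ℕ) : 0 < gapTerm d a (exp (-t)) k :=
  gapTerm_pos d a (exp_neg_pos_lt_one ht).1 (exp_neg_pos_lt_one ht).2 k

theorem gapTerm_le_gapSum {d : ℕ} (hd : 1 ≤ d) (a : ℕ) {t : ℝ} (ht : 0 < t) (k : ℕ) :
    gapTerm d a (exp (-t)) k ≤ gapSum d a t :=
  (summable_gapTerm_exp hd a ht).le_tsum k fun j _ => (gapTerm_exp_pos d a ht j).le

theorem gapSum_pos {d : ℕ} (hd : 1 ≤ d) (a : ℕ) {t : ℝ} (ht : 0 < t) : 0 < gapSum d a t :=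
  (gapTerm_exp_pos d a ht 0).trans_le (gapTerm_le_gapSum hd a ht 0)

theorem gaussian_exponent_le {d a : ℕ} (hd : 1 ≤ d) {t : ℝ} (ht : 0 < t) (ht1 : t ≤ 1) {m s : ℝ}
    (hm : |m - s / √t| ≤ 1) :
    -(d / 2 * t * m ^ 2) + (2 * d + a) * t * |m| ≤
      ((2 * d + a) + d / 2 + 2 * (2 * d + a) ^ 2 / d) + -(d / 8) * s ^ 2 := by
  have hd1 : (1 : ℝ) ≤ d := by exact_mod_cast hd
  have ha : (0 : ℝ) ≤ a := a.cast_nonneg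
  have hr := Real.sqrt_pos.2 ht
  have hr1 : √t ≤ 1 := Real.sqrt_le_one.2 ht1
  obtain ⟨D, hD⟩ : ∃ D, D = m - s / √t := ⟨_, rfl⟩
  rw [← hD] at hm
  have e1 : √t * m = s + √t * D := by rw [hD]; field_simp; ring
  have hrr : √t * √t = t := Real.mul_self_sqrt ht.le
  have hD2 : D ^ 2 ≤ 1 := by rw [← sq_abs]; nlinarith [abs_nonneg D]
  have h1 : s ^ 2 / 2 - 1 ≤ t * m ^ 2 := by
    have : t * m ^ 2 = (s + √t * D) ^ 2 := by rw [← e1, mul_pow, Real.sq_sqrt ht.le]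
    rw [this]
    have h2 : (√t * D) ^ 2 ≤ 1 := by
      rw [mul_pow, Real.sq_sqrt ht.le]; nlinarith [sq_nonneg D]
    nlinarith [sq_nonneg (s + 2 * (√t * D))]
  have h2 : t * |m| ≤ |s| + 1 := by
    have h3 : √t * |m| ≤ |s| + 1 := by
      have h4 : √t * |m| = |√t * m| := by rw [abs_mul, abs_of_pos hr]
      rw [h4, e1]
      refine (abs_add_le _ _).trans ?_
      rw [abs_mul, abs_of_pos hr]
      nlinarith [abs_nonneg D]
    have : t * |m| = √t * (√t * |m|) := by rw [← mul_assoc, hrr]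
    rw [this]
    nlinarith [mul_nonneg hr.le (abs_nonneg m)]
  have h3 : (2 * d + a : ℝ) * |s| ≤ d / 8 * s ^ 2 + 2 * (2 * d + a) ^ 2 / d := by
    rw [← sub_nonneg]
    have : d / 8 * s ^ 2 + 2 * (2 * d + a) ^ 2 / d - (2 * d + a : ℝ) * |s| =
        (d * |s| - 4 * (2 * d + a)) ^ 2 / (8 * d) := by
      rw [← sq_abs s]; field_simp; ring
    rw [this]; positivity
  have h4 : (2 * d + a) * t * |m| ≤ (2 * d + a : ℝ) * (|s| + 1) := by
    rw [mul_assoc]; gcongr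
  nlinarith

theorem tendsto_gapSum {d a : ℕ} (hd : 1 ≤ d) {u : ℝ} (hu : 0 < u)
    (hu' : log (1 - exp (-u)) = -(d * u)) :
    Tendsto (fun t => gapSum d a t * exp (gapRate d u / t)) (nhdsWithin 0 (Set.Ioi 0))
      (nhds ((√(2 * π * (1 - exp (-u))))⁻¹ * exp ((d / 2 - a) * u) *
        √(π / ((d + exp (-u) / (1 - exp (-u))) / 2)))) := by
  set B : ℝ := (d + exp (-u) / (1 - exp (-u))) / 2 with hB
  set c₀ : ℝ := (√(2 * π * (1 - exp (-u))))⁻¹ * exp ((d / 2 - a) * u) with hc₀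
  have hnonneg : ∀ s : ℝ, ∀ᶠ t in nhdsWithin 0 (Set.Ioi 0), 0 ≤ u / t + s / √t := by
    intro s
    have h1 : Tendsto (fun t => u + s * √t) (nhdsWithin 0 (Set.Ioi 0)) (nhds u) := by
      simpa using (tendsto_sqrt_nhdsGT_zero.const_mul s).const_add u
    filter_upwards [h1.eventually (lt_mem_nhds hu), self_mem_nhdsWithin] with t h2 ht
    have ht : 0 < t := ht
    have h3 : u / t + s / √t = (u + s * √t) / t := by
      have := Real.sqrt_pos.2 ht
      have hrr : √t * √t = t := Real.mul_self_sqrt ht.le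
      field_simp
      linear_combination (-s) * hrr
    rw [h3]
    positivity
  have hidx : ∀ s : ℝ, Tendsto (fun t => ((⌊u / t + s / √t⌋₊ : ℝ) * t - u) / √t)
      (nhdsWithin 0 (Set.Ioi 0)) (nhds s) := by
    intro s
    have h1 : Tendsto (fun t : ℝ => s - √t) (nhdsWithin 0 (Set.Ioi 0)) (nhds s) := by
      simpa using tendsto_sqrt_nhdsGT_zero.const_sub s
    refine tendsto_of_tendsto_of_tendsto_of_le_of_le' h1 tendsto_const_nhds ?_ ?_
    all_goals
      filter_upwards [hnonneg s, self_mem_nhdsWithin] with t h2 ht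
      have ht : 0 < t := ht
      have hr := Real.sqrt_pos.2 ht
      have hrr : √t * √t = t := Real.mul_self_sqrt ht.le
      have e : (u / t + s / √t) * t = u + s * √t := by
        rw [add_mul, div_mul_cancel₀ _ ht.ne']
        nth_rw 2 [← hrr]
        field_simp
      have h3 := mul_le_mul_of_nonneg_right (Nat.floor_le h2) ht.le
      have h4 := mul_le_mul_of_nonneg_right (Nat.lt_floor_add_one (u / t + s / √t)).le ht.le
      rw [e] at h3 h4
    · rw [le_div_iff₀ hr]
      nlinarith
    · rw [div_le_iff₀ hr]
      nlinarith
  have hK : ∀ᶠ t in nhdsWithin 0 (Set.Ioi 0),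
      gapTerm d a (exp (-t)) ⌊u / t⌋₊ * exp (gapRate d u / t) / √t ≤ c₀ + 1 := by
    have h0 := hidx 0
    simp only [zero_div, add_zero] at h0
    have := tendsto_gapTerm (a := a) hu hu' h0
    rw [← hc₀] at this
    simp only [ne_eq, OfNat.ofNat_ne_zero, not_false_eq_true, zero_pow, mul_zero, exp_zero,
      mul_one] at this
    filter_upwards [this.eventually (gt_mem_nhds (lt_add_one c₀))] with t ht using ht.le
  have hgaussian : ∫ s : ℝ, c₀ * exp (-B * s ^ 2) = c₀ * √(π / B) := by
    rw [MeasureTheory.integral_const_mul, integral_gaussian]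
  rw [← hgaussian]
  have key : Tendsto (fun t => ∫ s : ℝ, (Set.Ici (0 : ℝ)).indicator
        (fun x => gapTerm d a (exp (-t)) ⌊x⌋₊) (u / t + s / √t) / √t * exp (gapRate d u / t))
      (nhdsWithin 0 (Set.Ioi 0)) (nhds (∫ s : ℝ, c₀ * exp (-B * s ^ 2))) := by
    refine MeasureTheory.tendsto_integral_filter_of_dominated_convergence
      (fun s => (c₀ + 1) * exp (((2 * d + a) + d / 2 + 2 * (2 * d + a) ^ 2 / d) +
        -(d / 8) * s ^ 2)) ?_ ?_ ?_ ?_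
    · refine Eventually.of_forall fun t => Measurable.aestronglyMeasurable ?_
      have h1 : Measurable ((Set.Ici (0 : ℝ)).indicator
          fun x : ℝ => gapTerm d a (exp (-t)) ⌊x⌋₊) :=
        ((measurable_of_countable (gapTerm d a (exp (-t)))).comp
          Nat.measurable_floor).indicator measurableSet_Ici
      have h2 : Measurable fun s : ℝ => u / t + s / √t := by fun_prop
      exact ((h1.comp h2).div_const _).mul_const _
    · filter_upwards [self_mem_nhdsWithin, hK,
        (gt_mem_nhds (zero_lt_one' ℝ)).filter_mono nhdsWithin_le_nhds] with t ht hKt ht1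
      have ht : 0 < t := ht
      refine Eventually.of_forall fun s => ?_
      have hc1 : 0 ≤ c₀ + 1 := by positivity
      by_cases hx : 0 ≤ u / t + s / √t
      · rw [Set.indicator_of_mem (Set.mem_Ici.2 hx), norm_of_nonneg (by
          have := gapTerm_exp_pos d a ht ⌊u / t + s / √t⌋₊
          positivity)]
        have hg := gapTerm_le_gaussian (a := a) hu hu' ht ⌊u / t + s / √t⌋₊
        have hm : |((⌊u / t + s / √t⌋₊ : ℝ) - ⌊u / t⌋₊) - s / √t| ≤ 1 := by
          have h1 := Nat.floor_le hx
          have h2 := Nat.lt_floor_add_one (u / t + s / √t)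
          have h3 := Nat.floor_le (div_pos hu ht).le
          have h4 := Nat.lt_floor_add_one (u / t)
          rw [abs_le]; constructor <;> linarith
        have he := exp_le_exp.2 (gaussian_exponent_le (a := a) hd ht ht1.le hm)
        calc _ ≤ gapTerm d a (exp (-t)) ⌊u / t⌋₊ * exp (-(d / 2 * t *
                ((⌊u / t + s / √t⌋₊ : ℝ) - ⌊u / t⌋₊) ^ 2) +
              (2 * d + a) * t * |(⌊u / t + s / √t⌋₊ : ℝ) - ⌊u / t⌋₊|) / √t *
                exp (gapRate d u / t) := by gcongr
          _ = gapTerm d a (exp (-t)) ⌊u / t⌋₊ * exp (gapRate d u / t) / √t * exp (-(d / 2 * t *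
                ((⌊u / t + s / √t⌋₊ : ℝ) - ⌊u / t⌋₊) ^ 2) +
              (2 * d + a) * t * |(⌊u / t + s / √t⌋₊ : ℝ) - ⌊u / t⌋₊|) := by ring
          _ ≤ _ := by gcongr
      · rw [Set.indicator_of_notMem (by simpa using hx)]
        simp only [zero_div, zero_mul, norm_zero]
        positivity
    · simp_rw [exp_add]
      have : (0 : ℝ) < d / 8 := by positivity
      exact ((integrable_exp_neg_mul_sq this).const_mul _).const_mul _
    · refine Eventually.of_forall fun s => ?_
      refine (tendsto_gapTerm (a := a) hu hu' (hidx s)).congr' ?_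
      filter_upwards [hnonneg s] with t ht
      rw [Set.indicator_of_mem (Set.mem_Ici.2 ht)]
      ring
  refine key.congr' ?_
  filter_upwards [self_mem_nhdsWithin] with t ht
  rw [MeasureTheory.integral_mul_const, gapSum, tsum_eq_integral_rescaled
    (fun k => (gapTerm_exp_pos d a ht k).le) (summable_gapTerm_exp hd a ht) (u / t)
    (Real.sqrt_pos.2 ht)]

/-- The terms with small index contribute an exponentially small fraction of the sum. -/
theorem sum_gapTerm_le {d a : ℕ} (hd : 1 ≤ d) {u : ℝ} (hu : 0 < u)
    (hu' : log (1 - exp (-u)) = -(d * u)) {t : ℝ} (ht : 0 < t) (htu : t ≤ u / 4) {J : ℕ}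
    (hJ : J * t ≤ u / 4) :
    ∑ k ∈ Finset.range J, gapTerm d a (exp (-t)) k ≤
      gapSum d a t * (u / 4 / t * exp ((2 * d + a) * u - d * u ^ 2 / 8 / t)) := by
  have hterm : ∀ k ∈ Finset.range J, gapTerm d a (exp (-t)) k ≤
      gapSum d a t * exp ((2 * d + a) * u - d * u ^ 2 / 8 / t) := by
    intro k hk
    have hkJ : (k : ℝ) ≤ J := by exact_mod_cast (Finset.mem_range.1 hk).le
    refine (gapTerm_le_gaussian hu hu' ht k).trans ?_
    refine mul_le_mul (gapTerm_le_gapSum hd a ht _) (exp_le_exp.2 ?_) (exp_pos _).le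
      (gapSum_pos hd a ht).le
    have h3 := Nat.floor_le (div_pos hu ht).le
    have h4 := Nat.lt_floor_add_one (u / t)
    rw [le_div_iff₀ ht] at h3
    rw [div_lt_iff₀ ht] at h4
    generalize (⌊u / t⌋₊ : ℝ) = K at *
    have h5 : (k : ℝ) * t ≤ u / 4 := (mul_le_mul_of_nonneg_right hkJ ht.le).trans hJ
    have hk0 : 0 ≤ (k : ℝ) * t := by positivity
    have h6 : u / 2 ≤ (K - k) * t := by nlinarith
    have h7 : (K - k) * t ≤ u := by nlinarith
    have h8 : 0 < K - k := by
      by_contra! h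
      nlinarith [mul_nonneg (sub_nonneg.2 h) ht.le]
    have h9 : |(k : ℝ) - K| = K - k := by rw [abs_sub_comm, abs_of_pos h8]
    rw [h9, mul_assoc (2 * d + a : ℝ), mul_comm t (K - k)]
    have h10 : d * u ^ 2 / 8 / t ≤ d / 2 * t * ((k : ℝ) - K) ^ 2 := by
      rw [div_le_iff₀ ht]
      have : d / 2 * t * ((k : ℝ) - K) ^ 2 * t = d / 2 * ((K - k) * t) ^ 2 := by ring
      rw [this]
      have : (u / 2) ^ 2 ≤ ((K - k) * t) ^ 2 := by gcongr
      have hd0 : (0 : ℝ) ≤ d := d.cast_nonneg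
      nlinarith
    have h11 : (2 * d + a : ℝ) * ((K - k) * t) ≤ (2 * d + a) * u := by gcongr
    linarith
  refine (Finset.sum_le_card_nsmul _ _ _ hterm).trans ?_
  rw [Finset.card_range, nsmul_eq_mul]
  have h1 : (J : ℝ) ≤ u / 4 / t := by rwa [le_div_iff₀ ht]
  have h2 := gapSum_pos hd a ht
  calc _ ≤ u / 4 / t * (gapSum d a t * exp ((2 * d + a) * u - d * u ^ 2 / 8 / t)) := by gcongr
    _ = _ := by ring

theorem norm_one_sub_cexp_sq (v y : ℝ) : ‖1 - Complex.exp (-v + y * Complex.I)‖ ^ 2 =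
    (1 - exp (-v)) ^ 2 + 2 * exp (-v) * (1 - cos y) := by
  have h : Complex.exp (-v + y * Complex.I) =
      ((exp (-v) * cos y : ℝ) : ℂ) + ((exp (-v) * sin y : ℝ) : ℂ) * Complex.I := by
    rw [Complex.exp_add, Complex.exp_mul_I]
    push_cast
    ring
  have h2 : 1 - Complex.exp (-v + y * Complex.I) =
      ((1 - exp (-v) * cos y : ℝ) : ℂ) + ((-(exp (-v) * sin y) : ℝ) : ℂ) * Complex.I := by
    rw [h]; push_cast; ring
  rw [h2, ← Complex.normSq_eq_norm_sq, Complex.normSq_add_mul_I]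
  linear_combination exp (-v) ^ 2 * sin_sq_add_cos_sq y

theorem one_sub_exp_neg_le_mul_norm {v : ℝ} (hv : 0 < v) (hv1 : v ≤ 1) (y : ℝ) :
    1 - exp (-v) ≤ exp (-((1 - cos y) / 9)) * ‖1 - Complex.exp (-v + y * Complex.I)‖ := by
  have hr1 := one_sub_exp_neg_pos hv
  have hr3 : 1 / 3 ≤ exp (-v) := by
    have h1 : exp 1 ≤ 3 := exp_one_lt_three.le
    have h2 : exp (-1) ≤ exp (-v) := exp_le_exp.2 (by linarith)
    refine le_trans ?_ h2
    rw [exp_neg, one_div]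
    exact inv_anti₀ (exp_pos _) h1
  refine le_of_sq_le_sq ?_ (by positivity)
  rw [mul_pow, norm_one_sub_cexp_sq, ← exp_nat_mul]
  have hw0 : 0 ≤ 1 - cos y := sub_nonneg.2 (cos_le_one y)
  have hw2 : 1 - cos y ≤ 2 := by linarith [neg_one_le_cos y]
  generalize 1 - cos y = w at *
  generalize exp (-v) = r at *
  have h1 : 1 - 2 * w / 9 ≤ exp ((2 : ℕ) * -(w / 9)) := by
    have := add_one_le_exp ((2 : ℕ) * -(w / 9))
    push_cast at this ⊢
    linarith
  have h2 : (1 - 2 * w / 9) * ((1 - r) ^ 2 + 2 * r * w) ≤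
      exp ((2 : ℕ) * -(w / 9)) * ((1 - r) ^ 2 + 2 * r * w) := by
    have : 0 < r := by linarith
    gcongr
  refine le_trans ?_ h2
  have h3 : 0 ≤ w * (r - (1 - r) ^ 2 / 9 - 2 / 9 * r * w) := by
    apply mul_nonneg hw0
    have : (1 - r) ^ 2 ≤ 4 / 9 := by nlinarith
    nlinarith
  nlinarith

theorem cexp_pow (t θ : ℝ) (j : ℕ) : Complex.exp (-t + θ * Complex.I) ^ j =
    Complex.exp (-((j * t : ℝ) : ℂ) + ((j * θ : ℝ) : ℂ) * Complex.I) := by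
  rw [← Complex.exp_nat_mul]
  push_cast
  ring_nf

theorem norm_cexp_eq (t θ : ℝ) : ‖Complex.exp (-t + θ * Complex.I)‖ = exp (-t) := by
  simp [Complex.norm_exp]

theorem norm_gapTerm_cexp_le (d a : ℕ) {t : ℝ} (ht : 0 < t) (θ : ℝ) {J k : ℕ} (hJ : J * t ≤ 1)
    (hk : J ≤ k) :
    ‖gapTerm d a (Complex.exp (-t + θ * Complex.I)) k‖ ≤
      exp (-((∑ j ∈ Finset.range J, (1 - cos ((j + 1 : ℕ) * θ))) / 9)) *
        gapTerm d a (exp (-t)) k := by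
  have hpos := exp_neg_pos_lt_one ht
  rw [gapTerm, gapTerm, norm_div, norm_pow, norm_prod, norm_cexp_eq]
  have hfac : ∀ j : ℕ, 1 - exp (-t) ^ (j + 1) ≤
      ‖1 - Complex.exp (-t + θ * Complex.I) ^ (j + 1)‖ := by
    intro j
    have := norm_sub_norm_le (1 : ℂ) (Complex.exp (-t + θ * Complex.I) ^ (j + 1))
    rwa [norm_one, norm_pow, norm_cexp_eq] at this
  have hnn : ∀ j : ℕ, 0 < 1 - exp (-t) ^ (j + 1) := fun j =>
    sub_pos.2 (pow_lt_one₀ hpos.1.le hpos.2 j.succ_ne_zero)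
  have key : ∏ j ∈ Finset.range k, (1 - exp (-t) ^ (j + 1)) ≤
      exp (-((∑ j ∈ Finset.range J, (1 - cos ((j + 1 : ℕ) * θ))) / 9)) *
        ∏ j ∈ Finset.range k, ‖1 - Complex.exp (-t + θ * Complex.I) ^ (j + 1)‖ := by
    rw [← Finset.prod_range_mul_prod_Ico _ hk, ← Finset.prod_range_mul_prod_Ico _ hk, ← mul_assoc,
      Finset.sum_div, ← Finset.sum_neg_distrib, exp_sum, ← Finset.prod_mul_distrib]
    refine mul_le_mul (Finset.prod_le_prod (fun j _ => (hnn j).le) fun j hj => ?_)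
      (Finset.prod_le_prod (fun j _ => (hnn j).le) fun j _ => hfac j)
      (Finset.prod_nonneg fun j _ => (hnn j).le) (Finset.prod_nonneg fun j _ => by positivity)
    have h1 : ((j + 1 : ℕ) : ℝ) * t ≤ 1 := by
      refine le_trans ?_ hJ
      have : ((j + 1 : ℕ) : ℝ) ≤ J := by exact_mod_cast Finset.mem_range.1 hj
      gcongr
    have h2 := one_sub_exp_neg_le_mul_norm (v := (j + 1 : ℕ) * t) (by positivity) h1
      ((j + 1 : ℕ) * θ)
    rw [cexp_pow, ← exp_nat_mul, mul_neg]
    exact h2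
  have hP : 0 < ∏ j ∈ Finset.range k, (1 - exp (-t) ^ (j + 1)) :=
    Finset.prod_pos fun j _ => hnn j
  have hQ : 0 < ∏ j ∈ Finset.range k, ‖1 - Complex.exp (-t + θ * Complex.I) ^ (j + 1)‖ :=
    Finset.prod_pos fun j _ => (hnn j).trans_le (hfac j)
  rw [div_le_iff₀ hQ, mul_right_comm, mul_div_left_comm]
  exact le_mul_of_one_le_right (pow_nonneg hpos.1.le _) ((one_le_div hP).2 key)

theorem cube_div_three_le_sum_sq (J : ℕ) :
    (J : ℝ) ^ 3 / 3 ≤ ∑ j ∈ Finset.range J, ((j + 1 : ℕ) : ℝ) ^ 2 := by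
  induction J with
  | zero => simp
  | succ J ih =>
    rw [Finset.sum_range_succ]
    push_cast at ih ⊢
    nlinarith [J.cast_nonneg (α := ℝ)]

theorem sum_one_sub_cos_ge_of_small {J : ℕ} {θ : ℝ} (h : J * |θ| ≤ π) :
    2 / (3 * π ^ 2) * θ ^ 2 * (J : ℝ) ^ 3 ≤
      ∑ j ∈ Finset.range J, (1 - cos ((j + 1 : ℕ) * θ)) := by
  have h1 : ∀ j ∈ Finset.range J, 2 / π ^ 2 * θ ^ 2 * ((j + 1 : ℕ) : ℝ) ^ 2 ≤
      1 - cos ((j + 1 : ℕ) * θ) := by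
    intro j hj
    have h2 : |((j + 1 : ℕ) : ℝ) * θ| ≤ π := by
      rw [abs_mul, Nat.abs_cast]
      refine le_trans ?_ h
      have : ((j + 1 : ℕ) : ℝ) ≤ J := by exact_mod_cast Finset.mem_range.1 hj
      gcongr
    have h3 := cos_le_one_sub_mul_cos_sq h2
    rw [mul_pow] at h3
    linarith
  refine le_trans ?_ (Finset.sum_le_sum h1)
  rw [← Finset.mul_sum]
  calc _ = 2 / π ^ 2 * θ ^ 2 * ((J : ℝ) ^ 3 / 3) := by field_simp
    _ ≤ _ := by
      have := cube_div_three_le_sum_sq J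
      gcongr

theorem two_mul_sin_mul_sum_cos (J : ℕ) (θ : ℝ) :
    2 * sin (θ / 2) * ∑ j ∈ Finset.range J, cos ((j + 1 : ℕ) * θ) =
      sin ((J + 1 / 2) * θ) - sin (θ / 2) := by
  induction J with
  | zero => simp; ring_nf
  | succ J ih =>
    rw [Finset.sum_range_succ, mul_add, ih]
    have h1 : (((J + 1 : ℕ) : ℝ) + 1 / 2) * θ = (J + 1 : ℕ) * θ + θ / 2 := by push_cast; ring
    have h2 : ((J : ℝ) + 1 / 2) * θ = (J + 1 : ℕ) * θ - θ / 2 := by push_cast; ring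
    rw [h1, h2, sin_add, sin_sub]
    ring

theorem sum_one_sub_cos_ge_of_large {J : ℕ} (hJ : 0 < J) {θ : ℝ} (h : π < J * |θ|)
    (hθ : |θ| ≤ π) :
    (J : ℝ) / 2 ≤ ∑ j ∈ Finset.range J, (1 - cos ((j + 1 : ℕ) * θ)) := by
  wlog hpos : 0 ≤ θ generalizing θ
  · have := this (θ := -θ) (by rwa [abs_neg]) (by rwa [abs_neg]) (by linarith)
    simpa using this
  rw [abs_of_nonneg hpos] at h hθ
  have hJ' : (0 : ℝ) < J := by exact_mod_cast hJ
  have h1 := two_mul_sin_mul_sum_cos J θ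
  have h2 : 1 / J ≤ sin (θ / 2) := by
    refine le_trans ?_ (mul_le_sin (by positivity) (by linarith))
    rw [div_le_iff₀ hJ']
    have := pi_pos
    field_simp
    linarith
  have hs : 0 < sin (θ / 2) := lt_of_lt_of_le (by positivity) h2
  have h3 := sin_le_one ((J + 1 / 2) * θ)
  rw [Finset.sum_sub_distrib, Finset.sum_const, Finset.card_range, nsmul_eq_mul, mul_one]
  generalize ∑ j ∈ Finset.range J, cos ((j + 1 : ℕ) * θ) = S at *
  rw [div_le_iff₀ hJ'] at h2
  by_contra! hcon
  have h4 : (J : ℝ) / 2 < S := by linarith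
  nlinarith

theorem exp_neg_div_le {c t : ℝ} (hc : 0 < c) (ht : 0 < t) (n : ℕ) :
    exp (-(c / t)) ≤ n.factorial * (t / c) ^ n := by
  have h := pow_div_factorial_le_exp (c / t) (by positivity) n
  rw [exp_neg]
  have h2 : (0 : ℝ) < (c / t) ^ n / n.factorial := by positivity
  refine (inv_anti₀ h2 h).trans_eq ?_
  rw [inv_div, ← inv_div c t, inv_pow, div_eq_mul_inv]

theorem exists_norm_tsum_gapTerm_le {d : ℕ} (hd : 1 ≤ d) (a : ℕ) {u : ℝ} (hu : 0 < u)
    (hu' : log (1 - exp (-u)) = -(d * u)) :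
    ∃ C, ∀ᶠ t in nhdsWithin 0 (Set.Ioi 0), ∀ s : ℝ, |s| * (t * √t) ≤ π →
      ‖∑' k, gapTerm d a (Complex.exp (-t + ((s * (t * √t) : ℝ) : ℂ) * Complex.I)) k‖ ≤
        C * (1 + s ^ 2)⁻¹ * gapSum d a t := by
  obtain ⟨δ, hδ0, hδ1, hδu⟩ : ∃ δ, 0 < δ ∧ δ ≤ 1 ∧ δ ≤ u / 4 :=
    ⟨min 1 (u / 4), by positivity, min_le_left _ _, min_le_right _ _⟩
  have hd0 : (0 : ℝ) < d := by exact_mod_cast hd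
  obtain ⟨c₁, hc₁⟩ : ∃ c, c = 1 / 9 * (2 / (3 * π ^ 2)) * (δ / 2) ^ 3 := ⟨_, rfl⟩
  have hc₁0 : 0 < c₁ := by rw [hc₁]; positivity
  obtain ⟨C₂, hC₂0, hC₂⟩ : ∃ C, 0 ≤ C ∧ ∀ t, 0 < t →
      u / 4 / t * exp ((2 * d + a) * u - d * u ^ 2 / 8 / t) ≤ C * t ^ 3 := by
    refine ⟨u / 4 * exp ((2 * d + a) * u) * ((4 : ℕ).factorial / (d * u ^ 2 / 8) ^ 4),
      by positivity, fun t ht => ?_⟩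
    have := exp_neg_div_le (c := d * u ^ 2 / 8) (by positivity) ht 4
    rw [sub_eq_add_neg, exp_add]
    calc _ ≤ u / 4 / t * (exp ((2 * d + a) * u) *
          ((4 : ℕ).factorial * (t / (d * u ^ 2 / 8)) ^ 4)) := by gcongr
      _ = _ := by field_simp
  obtain ⟨C₃, hC₃0, hC₃⟩ : ∃ C, 0 ≤ C ∧ ∀ t, 0 < t → exp (-(δ / 36 / t)) ≤ C * t ^ 3 := by
    refine ⟨(3 : ℕ).factorial / (δ / 36) ^ 3, by positivity, fun t ht => ?_⟩
    refine (exp_neg_div_le (by positivity) ht 3).trans_eq ?_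
    field_simp
  refine ⟨(C₂ + C₃) * (1 + π ^ 2) + (1 + 1 / c₁), ?_⟩
  filter_upwards [self_mem_nhdsWithin,
    (gt_mem_nhds (half_pos hδ0)).filter_mono nhdsWithin_le_nhds] with t ht htδ s hs
  have ht : 0 < t := ht
  set θ : ℝ := s * (t * √t) with hθ
  have hθ2 : θ ^ 2 = s ^ 2 * t ^ 3 := by
    rw [hθ, mul_pow, mul_pow, Real.sq_sqrt ht.le]; ring
  have hr := Real.sqrt_pos.2 ht
  have hθπ : |θ| ≤ π := by rwa [hθ, abs_mul, abs_of_pos (mul_pos ht hr)]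
  have hF := gapSum_pos hd a ht
  have ht3 : t ^ 3 ≤ (1 + π ^ 2) * (1 + s ^ 2)⁻¹ := by
    rw [← div_eq_mul_inv, le_div_iff₀ (by positivity), mul_add, mul_one, mul_comm _ (s ^ 2),
      ← hθ2]
    have h1 : t ^ 3 ≤ 1 := pow_le_one₀ ht.le (by linarith)
    have h2 : θ ^ 2 ≤ π ^ 2 := by rw [← sq_abs]; gcongr
    linarith
  obtain ⟨J, hJ1, hJ2⟩ : ∃ J : ℕ, (J : ℝ) * t ≤ δ ∧ δ / 2 / t ≤ J := by
    refine ⟨⌊δ / t⌋₊, ?_, ?_⟩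
    · rw [← le_div_iff₀ ht]; exact Nat.floor_le (by positivity)
    · have h1 := Nat.lt_floor_add_one (δ / t)
      have h2 : 1 ≤ δ / 2 / t := by rw [le_div_iff₀ ht]; linarith
      have h3 : δ / t = δ / 2 / t + δ / 2 / t := by ring
      linarith
  have hJ0 : 0 < J := by
    have : (0 : ℝ) < J := lt_of_lt_of_le (by positivity) hJ2
    exact_mod_cast this
  set φ := exp (-((∑ j ∈ Finset.range J, (1 - cos ((j + 1 : ℕ) * θ))) / 9)) with hφ
  have hφle : φ ≤ C₃ * t ^ 3 + (1 + 1 / c₁) * (1 + s ^ 2)⁻¹ := by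
    rcases le_or_gt (J * |θ|) π with h | h
    · have h1 := sum_one_sub_cos_ge_of_small h
      have h2 : c₁ * s ^ 2 ≤ (∑ j ∈ Finset.range J, (1 - cos ((j + 1 : ℕ) * θ))) / 9 := by
        have h3 : (δ / 2 / t) ^ 3 ≤ (J : ℝ) ^ 3 := by gcongr
        have h4 : c₁ * s ^ 2 = 2 / (3 * π ^ 2) * θ ^ 2 * (δ / 2 / t) ^ 3 / 9 := by
          rw [hc₁, hθ2]; field_simp
        rw [h4]
        have h5 : 2 / (3 * π ^ 2) * θ ^ 2 * (δ / 2 / t) ^ 3 ≤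
          2 / (3 * π ^ 2) * θ ^ 2 * (J : ℝ) ^ 3 := by gcongr
        linarith
      have h3 : φ ≤ (1 + c₁ * s ^ 2)⁻¹ := by
        rw [hφ, exp_neg]
        refine inv_anti₀ (by positivity) ?_
        have := add_one_le_exp ((∑ j ∈ Finset.range J, (1 - cos ((j + 1 : ℕ) * θ))) / 9)
        linarith
      have h4 : (1 + c₁ * s ^ 2)⁻¹ ≤ (1 + 1 / c₁) * (1 + s ^ 2)⁻¹ := by
        rw [← div_eq_mul_inv, le_div_iff₀ (by positivity), inv_mul_le_iff₀ (by positivity)]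
        have : (1 + c₁ * s ^ 2) * (1 + 1 / c₁) = 1 + s ^ 2 + (1 / c₁ + c₁ * s ^ 2) := by
          field_simp; ring
        rw [this]
        have : 0 ≤ 1 / c₁ + c₁ * s ^ 2 := by positivity
        linarith
      have h5 : 0 ≤ C₃ * t ^ 3 := by positivity
      linarith
    · have h1 := sum_one_sub_cos_ge_of_large hJ0 h hθπ
      have h2 : φ ≤ exp (-(δ / 36 / t)) := by
        refine exp_le_exp.2 (neg_le_neg ?_)
        have : δ / 36 / t = δ / 2 / t / 18 := by ring
        linarith
      have h3 := hC₃ t ht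
      have h4 : 0 ≤ (1 + 1 / c₁) * (1 + s ^ 2)⁻¹ := by positivity
      linarith
  have hx0 : Complex.exp (-t + (θ : ℂ) * Complex.I) ≠ 0 := Complex.exp_ne_zero _
  have hx1 : ‖Complex.exp (-t + (θ : ℂ) * Complex.I)‖ < 1 := by
    rw [norm_cexp_eq]; exact (exp_neg_pos_lt_one ht).2
  have hsum := summable_norm_gapTerm hd a hx0 hx1
  have hgs := summable_gapTerm_exp hd a ht
  have hpt : ∀ k, ‖gapTerm d a (Complex.exp (-t + (θ : ℂ) * Complex.I)) k‖ ≤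
      φ * gapTerm d a (exp (-t)) k +
        (Finset.range J : Set ℕ).indicator (gapTerm d a (exp (-t))) k := by
    intro k
    have hpk := gapTerm_exp_pos d a ht k
    rcases lt_or_ge k J with hk | hk
    · rw [Set.indicator_of_mem (by simpa using hk)]
      have := norm_gapTerm_le d a hx1 k
      rw [norm_cexp_eq] at this
      have : 0 ≤ φ * gapTerm d a (exp (-t)) k := by positivity
      linarith
    · rw [Set.indicator_of_notMem (by simpa using hk), add_zero]
      exact norm_gapTerm_cexp_le d a ht θ (hJ1.trans hδ1) hk
  have hind := hgs.indicator (Finset.range J : Set ℕ)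
  calc _ ≤ ∑' k, ‖gapTerm d a (Complex.exp (-t + (θ : ℂ) * Complex.I)) k‖ :=
        norm_tsum_le_tsum_norm hsum
    _ ≤ ∑' k, (φ * gapTerm d a (exp (-t)) k +
        (Finset.range J : Set ℕ).indicator (gapTerm d a (exp (-t))) k) :=
        hsum.tsum_le_tsum hpt ((hgs.mul_left φ).add hind)
    _ = φ * gapSum d a t + ∑ k ∈ Finset.range J, gapTerm d a (exp (-t)) k := by
        rw [(hgs.mul_left φ).tsum_add hind, tsum_mul_left, gapSum, sum_eq_tsum_indicator]
    _ ≤ φ * gapSum d a t +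
        gapSum d a t * (u / 4 / t * exp ((2 * d + a) * u - d * u ^ 2 / 8 / t)) := by
        gcongr
        exact sum_gapTerm_le hd hu hu' ht (by linarith) (hJ1.trans hδu)
    _ ≤ (C₃ * t ^ 3 + (1 + 1 / c₁) * (1 + s ^ 2)⁻¹) * gapSum d a t +
        gapSum d a t * (C₂ * t ^ 3) := by
        exact add_le_add (mul_le_mul_of_nonneg_right hφle hF.le)
          (mul_le_mul_of_nonneg_left (hC₂ t ht) hF.le)
    _ = ((C₂ + C₃) * t ^ 3 + (1 + 1 / c₁) * (1 + s ^ 2)⁻¹) * gapSum d a t := by ring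
    _ ≤ ((C₂ + C₃) * ((1 + π ^ 2) * (1 + s ^ 2)⁻¹) + (1 + 1 / c₁) * (1 + s ^ 2)⁻¹) *
        gapSum d a t := by gcongr
    _ = _ := by ring

/-- The value at `exp (-t)` of the power series with coefficients `a`. -/
noncomputable def expSeries (a : ℕ → ℝ) (t : ℝ) : ℝ := ∑' n, a n * exp (-t) ^ n

/-- The real tilted ratio of two values of `expSeries`, at the scale `t ^ (3 / 2)`. -/
noncomputable def tiltedRatio (a : ℕ → ℝ) (A t s : ℝ) : ℝ :=
  expSeries a (t - s * (t * √t)) * exp (-(A / t ^ 2 * (s * (t * √t)))) / expSeries a t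

/-- The holomorphic extension of `tiltedRatio` in its last variable. -/
noncomputable def tiltedRatioC (a : ℕ → ℝ) (A t : ℝ) (z : ℂ) : ℂ :=
  (∑' n, (a n : ℂ) * Complex.exp (-t + z * ((t * √t : ℝ) : ℂ)) ^ n) *
    Complex.exp (-(((A / t ^ 2 : ℝ) : ℂ) * (z * ((t * √t : ℝ) : ℂ)))) / (expSeries a t : ℂ)

section Saddle

variable {a : ℕ → ℝ} {A C : ℝ}

theorem eventually_mul_sqrt_lt_one (s : ℝ) :
    ∀ᶠ t : ℝ in nhdsWithin 0 (Set.Ioi 0), 0 < t ∧ s * √t < 1 := by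
  have h := tendsto_sqrt_nhdsGT_zero.const_mul s
  rw [mul_zero] at h
  filter_upwards [self_mem_nhdsWithin, h.eventually (gt_mem_nhds one_pos)] with t ht h1
  exact ⟨ht, h1⟩

theorem shift_pos {t s : ℝ} (ht : 0 < t) (h : s * √t < 1) : 0 < t - s * (t * √t) := by
  have : t - s * (t * √t) = t * (1 - s * √t) := by ring
  rw [this]
  exact mul_pos ht (sub_pos.2 h)

theorem tendsto_tiltedRatio (hC : 0 < C)
    (hlim : Tendsto (fun t => expSeries a t * exp (-(A / t))) (nhdsWithin 0 (Set.Ioi 0)) (nhds C))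
    (s : ℝ) :
    Tendsto (fun t => tiltedRatio a A t s) (nhdsWithin 0 (Set.Ioi 0)) (nhds (exp (A * s ^ 2))) := by
  have hr := (tendsto_sqrt_nhdsGT_zero.const_mul s).const_sub 1
  rw [mul_zero, sub_zero] at hr
  have hid : Tendsto (fun t : ℝ => t) (nhdsWithin 0 (Set.Ioi 0)) (nhds 0) :=
    tendsto_id.mono_left nhdsWithin_le_nhds
  have hshift : Tendsto (fun t => t - s * (t * √t)) (nhdsWithin 0 (Set.Ioi 0))
      (nhdsWithin 0 (Set.Ioi 0)) := by
    refine tendsto_nhdsWithin_of_tendsto_nhds_of_eventually_within _ ?_ ?_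
    · have := hid.mul hr
      rw [zero_mul] at this
      refine this.congr fun t => ?_
      ring
    · filter_upwards [eventually_mul_sqrt_lt_one s] with t ht
      exact shift_pos ht.1 ht.2
  have h1 := (hlim.comp hshift).div hlim hC.ne'
  have h2 := (tendsto_const_nhds (x := A * s ^ 2)).div hr one_ne_zero
  have h3 := h1.mul h2.rexp
  rw [div_self hC.ne', one_mul, div_one] at h3
  refine h3.congr' ?_
  filter_upwards [eventually_mul_sqrt_lt_one s] with t ht
  have hp := shift_pos ht.1 ht.2
  have ht0 := ht.1
  simp only [Function.comp, Pi.div_apply]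
  rw [tiltedRatio]
  have hq : 1 - s * √t ≠ 0 := (sub_pos.2 ht.2).ne'
  have e : exp (-(A / (t - s * (t * √t)))) * exp (A * s ^ 2 / (1 - s * √t)) =
      exp (-(A / t ^ 2 * (s * (t * √t)))) * exp (-(A / t)) := by
    rw [← exp_add, ← exp_add]
    congr 1
    have h4 : t - s * (t * √t) = t * (1 - s * √t) := by ring
    have h5 : √t ^ 2 = t := Real.sq_sqrt ht0.le
    rw [h4]
    field_simp
    linear_combination (-A * s ^ 2) * h5
  have h6 := exp_pos (-(A / t))
  rw [div_mul_eq_mul_div, mul_assoc, e, ← mul_assoc, mul_div_mul_right _ _ h6.ne']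

theorem tilted_term_eq (t s : ℝ) (n : ℕ) :
    a n * exp (-(t - s * (t * √t))) ^ n * exp (-(A / t ^ 2 * (s * (t * √t)))) =
      a n * exp (-t) ^ n * exp (s * ((n - A / t ^ 2) * (t * √t))) := by
  rw [← exp_nat_mul, ← exp_nat_mul, mul_assoc, mul_assoc, ← exp_add, ← exp_add]
  ring_nf

theorem expSeries_nonneg (ha : ∀ n, 0 ≤ a n) (t : ℝ) : 0 ≤ expSeries a t :=
  tsum_nonneg fun n => mul_nonneg (ha n) (by positivity)

theorem tiltedRatio_le (ha : ∀ n, 0 ≤ a n)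
    (hs : ∀ t, 0 < t → Summable fun n => a n * exp (-t) ^ n) {t s R : ℝ} (ht : 0 < t)
    (hR : R * √t < 1) (hsR : |s| ≤ R) :
    tiltedRatio a A t s ≤ tiltedRatio a A t R + tiltedRatio a A t (-R) := by
  have hr : 0 ≤ √t := Real.sqrt_nonneg t
  have hpos : ∀ x, |x| ≤ R → 0 < t - x * (t * √t) := fun x hx => shift_pos ht
    ((mul_le_mul_of_nonneg_right ((le_abs_self x).trans hx) hr).trans_lt hR)
  have hR0 : 0 ≤ R := (abs_nonneg s).trans hsR
  have h1 := (hs _ (hpos s hsR)).mul_right (exp (-(A / t ^ 2 * (s * (t * √t)))))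
  have h2 := (hs _ (hpos R (abs_of_nonneg hR0).le)).mul_right
    (exp (-(A / t ^ 2 * (R * (t * √t)))))
  have h3 := (hs _ (hpos (-R) (by rw [abs_neg, abs_of_nonneg hR0]))).mul_right
    (exp (-(A / t ^ 2 * (-R * (t * √t)))))
  rw [tiltedRatio, tiltedRatio, tiltedRatio, ← add_div]
  refine div_le_div_of_nonneg_right ?_ (expSeries_nonneg ha t)
  rw [expSeries, expSeries, expSeries, ← tsum_mul_right, ← tsum_mul_right, ← tsum_mul_right,
    ← h2.tsum_add h3]
  refine h1.tsum_le_tsum (fun n => ?_) (h2.add h3)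
  rw [tilted_term_eq, tilted_term_eq, tilted_term_eq, ← mul_add]
  refine mul_le_mul_of_nonneg_left ?_ (mul_nonneg (ha n) (by positivity))
  generalize ((n : ℝ) - A / t ^ 2) * (t * √t) = c
  have h4 : s * c ≤ |R * c| := by
    refine (le_abs_self _).trans ?_
    rw [abs_mul, abs_mul, abs_of_nonneg hR0]
    gcongr
  rcases abs_choice (R * c) with h | h
  · rw [h] at h4
    linarith [exp_le_exp.2 h4, exp_pos (-R * c)]
  · rw [h, ← neg_mul] at h4
    linarith [exp_le_exp.2 h4, exp_pos (R * c)]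

theorem norm_cexp_shift (t : ℝ) (z : ℂ) :
    ‖Complex.exp (-t + z * ((t * √t : ℝ) : ℂ))‖ = exp (-(t - z.re * (t * √t))) := by
  rw [Complex.norm_exp]
  congr 1
  simp
  ring

theorem norm_tiltedRatioC_le (ha : ∀ n, 0 ≤ a n)
    (hs : ∀ t, 0 < t → Summable fun n => a n * exp (-t) ^ n) {t : ℝ} (ht : 0 < t) {z : ℂ}
    (hz : z.re * √t < 1) :
    ‖tiltedRatioC a A t z‖ ≤ tiltedRatio a A t z.re := by
  have h1 : ∀ n, ‖(a n : ℂ) * Complex.exp (-t + z * ((t * √t : ℝ) : ℂ)) ^ n‖ =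
      a n * exp (-(t - z.re * (t * √t))) ^ n := by
    intro n
    rw [norm_mul, norm_pow, norm_cexp_shift, Complex.norm_of_nonneg (ha n)]
  have h2 := hs _ (shift_pos ht hz)
  rw [tiltedRatioC, tiltedRatio, norm_div, norm_mul, Complex.norm_of_nonneg (expSeries_nonneg ha t),
    Complex.norm_exp]
  have h3 : (-(((A / t ^ 2 : ℝ) : ℂ) * (z * ((t * √t : ℝ) : ℂ)))).re =
      -(A / t ^ 2 * (z.re * (t * √t))) := by
    rw [Complex.neg_re, Complex.re_ofReal_mul, Complex.re_mul_ofReal]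
  rw [h3]
  refine div_le_div_of_nonneg_right (mul_le_mul_of_nonneg_right ?_ (exp_pos _).le)
    (expSeries_nonneg ha t)
  rw [expSeries, ← tsum_congr h1]
  refine norm_tsum_le_tsum_norm ?_
  simp_rw [h1]
  exact h2

theorem tiltedRatioC_ofReal (t s : ℝ) :
    tiltedRatioC a A t s = (tiltedRatio a A t s : ℂ) := by
  have h : ((expSeries a (t - s * (t * √t)) : ℝ) : ℂ) =
      ∑' n, (a n : ℂ) * Complex.exp (-t + (s : ℂ) * ((t * √t : ℝ) : ℂ)) ^ n := by
    rw [expSeries, Complex.ofReal_tsum]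
    refine tsum_congr fun n => ?_
    push_cast
    ring_nf
  rw [tiltedRatioC, tiltedRatio, ← h]
  push_cast
  ring_nf

theorem differentiableOn_tiltedRatioC (ha : ∀ n, 0 ≤ a n)
    (hs : ∀ t, 0 < t → Summable fun n => a n * exp (-t) ^ n) {t R : ℝ} (ht : 0 < t)
    (hR : R * √t < 1) :
    DifferentiableOn ℂ (tiltedRatioC a A t) (Metric.ball 0 R) := by
  have h1 : DifferentiableOn ℂ
      (fun z => ∑' n, (a n : ℂ) * Complex.exp (-t + z * ((t * √t : ℝ) : ℂ)) ^ n)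
      (Metric.ball 0 R) := by
    refine Complex.differentiableOn_tsum_of_summable_norm (hs _ (shift_pos ht hR)) (fun n => ?_)
      Metric.isOpen_ball fun n z hz => ?_
    · fun_prop
    · rw [norm_mul, norm_pow, norm_cexp_shift, Complex.norm_of_nonneg (ha n)]
      have hz' : z.re ≤ R := (Complex.re_le_norm z).trans (mem_ball_zero_iff.1 hz).le
      have := ha n
      gcongr
  have h2 : DifferentiableOn ℂ
      (fun z => Complex.exp (-(((A / t ^ 2 : ℝ) : ℂ) * (z * ((t * √t : ℝ) : ℂ)))))
      (Metric.ball 0 R) := by fun_prop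
  exact (h1.mul h2).div_const _

theorem tendsto_tiltedRatioC (hC : 0 < C) (ha : ∀ n, 0 ≤ a n)
    (hs : ∀ t, 0 < t → Summable fun n => a n * exp (-t) ^ n)
    (hlim : Tendsto (fun t => expSeries a t * exp (-(A / t))) (nhdsWithin 0 (Set.Ioi 0)) (nhds C))
    (z : ℂ) :
    Tendsto (fun t => tiltedRatioC a A t z) (nhdsWithin 0 (Set.Ioi 0))
      (nhds (Complex.exp (A * z ^ 2))) := by
  set R : ℝ := 2 * ‖z‖ + 1 with hR
  set B₁ : ℝ := exp (A * R ^ 2) + exp (A * (-R) ^ 2) + 1 with hB₁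
  have hbound : ∀ᶠ t in nhdsWithin 0 (Set.Ioi 0), ∀ w ∈ Metric.ball (0 : ℂ) R,
      ‖tiltedRatioC a A t w‖ ≤ B₁ := by
    have h1 := (tendsto_tiltedRatio hC hlim R).add (tendsto_tiltedRatio hC hlim (-R))
    filter_upwards [eventually_mul_sqrt_lt_one R, h1.eventually (gt_mem_nhds (lt_add_one _))]
      with t ht h2 w hw
    have hw1 : |w.re| ≤ R := (Complex.abs_re_le_norm w).trans (mem_ball_zero_iff.1 hw).le
    have hw2 : w.re * √t < 1 :=
      (mul_le_mul_of_nonneg_right ((le_abs_self _).trans hw1) (Real.sqrt_nonneg t)).trans_lt ht.2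
    exact ((norm_tiltedRatioC_le ha hs ht.1 hw2).trans (tiltedRatio_le ha hs ht.1 ht.2 hw1)).trans
      h2.le
  have hgauss : ∀ w ∈ Metric.ball (0 : ℂ) R, ‖Complex.exp (A * w ^ 2)‖ ≤ exp (|A| * R ^ 2) := by
    intro w hw
    rw [Complex.norm_exp]
    refine exp_le_exp.2 ((Complex.re_le_norm _).trans ?_)
    rw [norm_mul, norm_pow, Complex.norm_real, Real.norm_eq_abs]
    have := (mem_ball_zero_iff.1 hw).le
    gcongr
  have key := tendsto_zero_of_tendsto_zero_real (l := nhdsWithin (0 : ℝ) (Set.Ioi 0))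
    (h := fun t w => tiltedRatioC a A t w - Complex.exp (A * w ^ 2)) (R := R)
    (B := B₁ + exp (|A| * R ^ 2)) (by positivity) ?_ ?_ ?_ (z := z) (by rw [hR]; linarith)
  · have h := key.add_const (Complex.exp (A * z ^ 2))
    rw [zero_add] at h
    exact h.congr fun t => sub_add_cancel _ _
  · filter_upwards [eventually_mul_sqrt_lt_one R] with t ht
    exact (differentiableOn_tiltedRatioC ha hs ht.1 ht.2).sub (by fun_prop)
  · filter_upwards [hbound] with t ht w hw
    exact (norm_sub_le _ _).trans (add_le_add (ht w hw) (hgauss w hw))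
  · intro x _ _
    have h1 := (Complex.continuous_ofReal.tendsto _).comp (tendsto_tiltedRatio hC hlim x)
    have h2 := h1.sub_const (Complex.exp (A * (x : ℂ) ^ 2))
    have h3 : ((exp (A * x ^ 2) : ℝ) : ℂ) = Complex.exp (A * (x : ℂ) ^ 2) := by push_cast; rfl
    rw [h3, sub_self] at h2
    refine h2.congr fun t => ?_
    rw [Function.comp, tiltedRatioC_ofReal]

theorem integral_cexp_int_mul_I (k : ℤ) :
    ∫ θ in (-π)..π, Complex.exp (k * Complex.I * θ) = if k = 0 then 2 * (π : ℂ) else 0 := by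
  split_ifs with h
  · subst h
    simp
    ring
  · have hk : (k : ℂ) * Complex.I ≠ 0 := mul_ne_zero (by exact_mod_cast h) Complex.I_ne_zero
    rw [integral_exp_mul_complex hk, div_eq_zero_iff]
    left
    rw [sub_eq_zero, Complex.exp_eq_exp_iff_exists_int]
    refine ⟨k, ?_⟩
    push_cast
    ring

theorem continuous_tsum_cexp (ha : ∀ n, 0 ≤ a n)
    (hs : ∀ t, 0 < t → Summable fun n => a n * exp (-t) ^ n) {t : ℝ} (ht : 0 < t) :
    Continuous fun θ : ℝ => ∑' n, (a n : ℂ) * Complex.exp (-t + θ * Complex.I) ^ n := by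
  refine continuous_tsum (fun n => by fun_prop) (hs t ht) fun n θ => ?_
  rw [norm_mul, norm_pow, norm_cexp_eq, Complex.norm_of_nonneg (ha n)]

theorem integral_tsum_cexp (ha : ∀ n, 0 ≤ a n)
    (hs : ∀ t, 0 < t → Summable fun n => a n * exp (-t) ^ n) {t : ℝ} (ht : 0 < t) (n : ℕ) :
    ∫ θ in (-π)..π, (∑' m, (a m : ℂ) * Complex.exp (-t + θ * Complex.I) ^ m) *
      Complex.exp (-(n * Complex.I * θ)) = 2 * π * (a n * exp (-t) ^ n : ℝ) := by
  have hnorm : ∀ (m : ℕ) (θ : ℝ), ‖(a m : ℂ) * Complex.exp (-t + θ * Complex.I) ^ m *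
      Complex.exp (-(n * Complex.I * θ))‖ = a m * exp (-t) ^ m := by
    intro m θ
    rw [norm_mul, norm_mul, norm_pow, norm_cexp_eq, Complex.norm_of_nonneg (ha m)]
    simp [Complex.norm_exp]
  have h1 : HasSum (fun m => ∫ θ in (-π)..π, (a m : ℂ) * Complex.exp (-t + θ * Complex.I) ^ m *
      Complex.exp (-(n * Complex.I * θ)))
      (∫ θ in (-π)..π, (∑' m, (a m : ℂ) * Complex.exp (-t + θ * Complex.I) ^ m) *
        Complex.exp (-(n * Complex.I * θ))) := by
    refine intervalIntegral.hasSum_integral_of_dominated_convergence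
      (fun m _ => a m * exp (-t) ^ m) (fun m => ?_) (fun m => ?_) ?_ ?_ ?_
    · exact Continuous.aestronglyMeasurable (by fun_prop)
    · exact Eventually.of_forall fun θ _ => (hnorm m θ).le
    · exact Eventually.of_forall fun θ _ => hs t ht
    · exact intervalIntegrable_const
    · refine Eventually.of_forall fun θ _ => ?_
      rw [← tsum_mul_right]
      refine Summable.hasSum (Summable.of_norm ?_)
      simp_rw [hnorm]
      exact hs t ht
  have h2 : ∀ m : ℕ, ∫ θ in (-π)..π, (a m : ℂ) * Complex.exp (-t + θ * Complex.I) ^ m *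
      Complex.exp (-(n * Complex.I * θ)) =
        if m = n then 2 * π * ((a n * exp (-t) ^ n : ℝ) : ℂ) else 0 := by
    intro m
    have h3 : ∀ θ : ℝ, (a m : ℂ) * Complex.exp (-t + θ * Complex.I) ^ m *
        Complex.exp (-(n * Complex.I * θ)) = ((a m * exp (-t) ^ m : ℝ) : ℂ) *
          Complex.exp (((m - n : ℤ) : ℂ) * Complex.I * θ) := by
      intro θ
      push_cast
      rw [← Complex.exp_nat_mul, ← Complex.exp_nat_mul, mul_assoc (a m : ℂ),
        mul_assoc (a m : ℂ), ← Complex.exp_add, ← Complex.exp_add]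
      ring_nf
    simp_rw [h3]
    rw [intervalIntegral.integral_const_mul, integral_cexp_int_mul_I]
    by_cases h : m = n
    · subst h; simp [mul_comm]
    · have : (m : ℤ) - n ≠ 0 := by omega
      simp [h, this]
  simp_rw [h2] at h1
  exact h1.unique (hasSum_ite_eq n _)

theorem ofReal_mul_I_mul (s τ : ℝ) :
    (s : ℂ) * Complex.I * (τ : ℂ) = ((s * τ : ℝ) : ℂ) * Complex.I := by
  push_cast
  ring

theorem integral_indicator_tiltedRatioC (ha : ∀ n, 0 ≤ a n)
    (hs : ∀ t, 0 < t → Summable fun n => a n * exp (-t) ^ n) {t : ℝ} (ht : 0 < t) {n : ℕ}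
    (hn : A / t ^ 2 = n) :
    ∫ s : ℝ, (Set.Ioc (-π / (t * √t)) (π / (t * √t))).indicator
      (fun s : ℝ => tiltedRatioC a A t (s * Complex.I)) s =
        ((2 * π * (a n * exp (-t) ^ n) / (t * √t * expSeries a t) : ℝ) : ℂ) := by
  have hτ : 0 < t * √t := mul_pos ht (Real.sqrt_pos.2 ht)
  have h1 : ∀ s : ℝ, tiltedRatioC a A t (s * Complex.I) =
      ((∑' m, (a m : ℂ) * Complex.exp (-t + ((s * (t * √t) : ℝ) : ℂ) * Complex.I) ^ m) *
        Complex.exp (-(n * Complex.I * ((s * (t * √t) : ℝ) : ℂ)))) / (expSeries a t : ℂ) := by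
    intro s
    rw [tiltedRatioC, hn, ofReal_mul_I_mul, Complex.ofReal_natCast, mul_assoc (n : ℂ),
      mul_comm Complex.I]
  simp_rw [h1]
  rw [MeasureTheory.integral_indicator measurableSet_Ioc, ← intervalIntegral.integral_of_le
    (by rw [neg_div]; linarith [div_pos pi_pos hτ]), intervalIntegral.integral_div,
    intervalIntegral.integral_comp_mul_right (fun θ : ℝ =>
      (∑' m, (a m : ℂ) * Complex.exp (-t + (θ : ℂ) * Complex.I) ^ m) *
        Complex.exp (-(n * Complex.I * (θ : ℂ)))) hτ.ne', div_mul_cancel₀ _ hτ.ne',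
    div_mul_cancel₀ _ hτ.ne', integral_tsum_cexp ha hs ht]
  rw [Complex.real_smul]
  push_cast
  rw [← div_eq_inv_mul, div_div]

theorem tendsto_integral_tiltedRatioC (hC : 0 < C) (ha : ∀ n, 0 ≤ a n)
    (hs : ∀ t, 0 < t → Summable fun n => a n * exp (-t) ^ n)
    (hlim : Tendsto (fun t => expSeries a t * exp (-(A / t))) (nhdsWithin 0 (Set.Ioi 0)) (nhds C))
    {K : ℝ} (hK : ∀ᶠ t in nhdsWithin 0 (Set.Ioi 0), ∀ s : ℝ, |s| * (t * √t) ≤ π →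
      ‖∑' n, (a n : ℂ) * Complex.exp (-t + ((s * (t * √t) : ℝ) : ℂ) * Complex.I) ^ n‖ ≤
        K * (1 + s ^ 2)⁻¹ * expSeries a t) :
    Tendsto (fun t => ∫ s : ℝ, (Set.Ioc (-π / (t * √t)) (π / (t * √t))).indicator
      (fun s : ℝ => tiltedRatioC a A t (s * Complex.I)) s) (nhdsWithin 0 (Set.Ioi 0))
      (nhds ((√(π / A) : ℝ) : ℂ)) := by
  have hgaussian : ∫ s : ℝ, Complex.exp (A * (s * Complex.I) ^ 2) = ((√(π / A) : ℝ) : ℂ) := by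
    rw [← integral_gaussian, ← integral_complex_ofReal]
    refine MeasureTheory.integral_congr_ae (Eventually.of_forall fun s => ?_)
    simp only
    push_cast
    rw [mul_pow, Complex.I_sq]
    ring_nf
  have hpos : ∀ᶠ t in nhdsWithin 0 (Set.Ioi 0), 0 < expSeries a t := by
    filter_upwards [hlim.eventually (lt_mem_nhds hC)] with t ht
    exact pos_of_mul_pos_left ht (exp_pos _).le
  have hτ : Tendsto (fun t : ℝ => t * √t) (nhdsWithin 0 (Set.Ioi 0)) (nhds 0) := by
    have := (tendsto_id.mono_left (nhdsWithin_le_nhds (a := (0 : ℝ)) (s := Set.Ioi 0))).mul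
      tendsto_sqrt_nhdsGT_zero
    simpa using this
  rw [← hgaussian]
  refine MeasureTheory.tendsto_integral_filter_of_dominated_convergence
    (fun s => |K| * (1 + s ^ 2)⁻¹) ?_ ?_ (integrable_inv_one_add_sq.const_mul _) ?_
  · filter_upwards [self_mem_nhdsWithin] with t ht
    have h1 : Continuous fun s : ℝ => ∑' n, (a n : ℂ) *
        Complex.exp (-t + s * Complex.I * ((t * √t : ℝ) : ℂ)) ^ n := by
      have := (continuous_tsum_cexp ha hs ht).comp (continuous_mul_const (t * √t))
      refine this.congr fun s => ?_
      simp only [Function.comp, ofReal_mul_I_mul]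
    have h2 : Continuous fun s : ℝ => tiltedRatioC a A t (s * Complex.I) := by
      unfold tiltedRatioC
      exact (h1.mul (by fun_prop)).div_const _
    exact h2.aestronglyMeasurable.indicator measurableSet_Ioc
  · filter_upwards [self_mem_nhdsWithin, hK, hpos] with t ht hKt hF
    have hτ : 0 < t * √t := mul_pos ht (Real.sqrt_pos.2 ht)
    refine Eventually.of_forall fun s => ?_
    by_cases hsm : s ∈ Set.Ioc (-π / (t * √t)) (π / (t * √t))
    · rw [Set.indicator_of_mem hsm, tiltedRatioC, norm_div, norm_mul,
        Complex.norm_of_nonneg hF.le, div_le_iff₀ hF]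
      have h1 : |s| * (t * √t) ≤ π := by
        rw [← le_div_iff₀ hτ, abs_le, ← neg_div]
        exact ⟨hsm.1.le, hsm.2⟩
      have h2 : ‖Complex.exp (-(((A / t ^ 2 : ℝ) : ℂ) *
          (s * Complex.I * ((t * √t : ℝ) : ℂ))))‖ = 1 := by
        rw [Complex.norm_exp, Complex.neg_re, Complex.re_ofReal_mul, Complex.re_mul_ofReal]
        simp
      rw [h2, mul_one, ofReal_mul_I_mul]
      refine (hKt s h1).trans ?_
      have := le_abs_self K
      gcongr
    · rw [Set.indicator_of_notMem hsm, norm_zero]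
      positivity
  · refine Eventually.of_forall fun s => ?_
    refine (tendsto_tiltedRatioC hC ha hs hlim (s * Complex.I)).congr' ?_
    have h1 := hτ.const_mul |s|
    rw [mul_zero] at h1
    filter_upwards [self_mem_nhdsWithin, h1.eventually (gt_mem_nhds pi_pos)] with t ht h2
    have hτ : 0 < t * √t := mul_pos ht (Real.sqrt_pos.2 ht)
    rw [← lt_div_iff₀ hτ, abs_lt, ← neg_div] at h2
    rw [Set.indicator_of_mem (Set.mem_Ioc.2 ⟨h2.1, h2.2.le⟩)]

/-- The saddle point method for a power series with nonnegative coefficients that grows like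
`C * exp (A / t)` at `exp (-t)` and satisfies a minor arc bound. -/
theorem tendsto_coeff_of_expSeries (hA : 0 < A) (hC : 0 < C) (ha : ∀ n, 0 ≤ a n)
    (hs : ∀ t, 0 < t → Summable fun n => a n * exp (-t) ^ n)
    (hlim : Tendsto (fun t => expSeries a t * exp (-(A / t))) (nhdsWithin 0 (Set.Ioi 0)) (nhds C))
    {K : ℝ} (hK : ∀ᶠ t in nhdsWithin 0 (Set.Ioi 0), ∀ s : ℝ, |s| * (t * √t) ≤ π →
      ‖∑' n, (a n : ℂ) * Complex.exp (-t + ((s * (t * √t) : ℝ) : ℂ) * Complex.I) ^ n‖ ≤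
        K * (1 + s ^ 2)⁻¹ * expSeries a t) :
    Tendsto (fun n : ℕ => a n * exp (-(2 * √(A * n))) / (√(A / n) * √√(A / n))) atTop
      (nhds (√(π / A) / (2 * π) * C)) := by
  have htn : Tendsto (fun n : ℕ => √(A / n)) atTop (nhdsWithin 0 (Set.Ioi 0)) := by
    refine tendsto_nhdsWithin_of_tendsto_nhds_of_eventually_within _ ?_ ?_
    · have := (Real.continuous_sqrt.tendsto 0).comp (tendsto_const_div_atTop_nhds_zero_nat A)
      rwa [Real.sqrt_zero] at this
    · filter_upwards [eventually_gt_atTop 0] with n hn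
      have : (0 : ℝ) < n := by exact_mod_cast hn
      exact Real.sqrt_pos.2 (by positivity)
  have h1 := (tendsto_integral_tiltedRatioC hC ha hs hlim hK).comp htn
  have h2 := (Complex.continuous_re.tendsto _).comp h1
  rw [Complex.ofReal_re] at h2
  have h3 := (h2.div_const (2 * π)).mul (hlim.comp htn)
  refine h3.congr' ?_
  filter_upwards [eventually_gt_atTop 0, (hlim.comp htn).eventually (lt_mem_nhds hC)] with n hn hF
  have hn : (0 : ℝ) < n := by exact_mod_cast hn
  simp only [Function.comp] at hF ⊢
  have ht : 0 < √(A / n) := Real.sqrt_pos.2 (by positivity)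
  have ht2 : √(A / n) ^ 2 = A / n := Real.sq_sqrt (by positivity)
  have e1 : √(A * n) = n * √(A / n) := by
    rw [← Real.sqrt_sq hn.le, ← Real.sqrt_mul (by positivity), Real.sqrt_sq hn.le]
    congr 1
    field_simp
  rw [integral_indicator_tiltedRatioC ha hs ht (n := n) (by rw [ht2]; field_simp),
    Complex.ofReal_re, e1]
  generalize √(A / n) = t at *
  have hA' : A / t = n * t := by
    have : A = n * t ^ 2 := by rw [ht2]; field_simp
    rw [this]; field_simp
  have hF' : 0 < expSeries a t := pos_of_mul_pos_left hF (exp_pos _).le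
  have e2 : exp (-(2 * (n * t))) = exp (-t) ^ n * exp (-(A / t)) := by
    rw [hA', ← exp_nat_mul, ← exp_add]; ring_nf
  have := Real.sqrt_pos.2 ht
  rw [e2]
  field_simp

end Saddle

theorem gapSum_const_sq {d : ℕ} (hd : 4 ≤ d) {α : ℝ} (hα0 : 0 < α) (hα : 1 - α = α ^ d) :
    ((√(2 * π * (1 - α)))⁻¹ * exp (((d : ℝ) / 2 - (2 : ℕ)) * -log α) *
      √(π / ((d + α / (1 - α)) / 2))) ^ 2 = (α ^ (d - 3) * ((d : ℝ) * α ^ (d - 1) + 1))⁻¹ := by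
  have hexp : exp (((d : ℝ) / 2 - (2 : ℕ)) * -log α) ^ 2 = (α ^ (d - 4))⁻¹ := by
    rw [← exp_nat_mul, ← Real.exp_log (pow_pos hα0 (d - 4)), ← exp_neg, Real.log_pow]
    congr 1
    rw [Nat.cast_sub hd]
    push_cast
    ring
  rw [mul_pow, mul_pow, hexp, inv_pow, hα, Real.sq_sqrt (by positivity),
    Real.sq_sqrt (by positivity)]
  obtain ⟨m, rfl⟩ := Nat.exists_eq_add_of_le hd
  rw [show 4 + m - 4 = m by omega, show 4 + m - 3 = m + 1 by omega,
    show 4 + m - 1 = m + 3 by omega]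
  field_simp
  ring

theorem sqrt_mul_sqrt_sqrt {x : ℝ} (hx : 0 ≤ x) : √x * √√x = x ^ ((3 : ℝ) / 4) := by
  rw [Real.sqrt_eq_rpow, Real.sqrt_eq_rpow, ← Real.rpow_mul hx,
    ← Real.rpow_add_of_nonneg hx (by norm_num) (by norm_num)]
  norm_num

/-- For every d ≥ 4, with α the unique root of x^d + x = 1 in (0,1) and
A_d = (d/2)(log α)² + Σ_{r≥1} α^{rd}/r², q_d^{(2)}(n) is asymptotic to
(A_d^{1/4}/(2√(π α^{d−3}(dα^{d−1}+1)))) n^{−3/4} exp(2√(A_d n)) as n → ∞. -/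
theorem qPart_asymptotic (d : ℕ) (hd : 4 ≤ d) (α A : ℝ)
    (hα : 0 < α ∧ α < 1 ∧ α ^ d + α = 1)
    (hA : A = (d : ℝ) / 2 * (Real.log α) ^ 2 +
      ∑' r : ℕ, α ^ ((r + 1) * d) / ((r : ℝ) + 1) ^ 2) :
    Tendsto (fun n : ℕ =>
      (qPart d 2 n : ℝ) /
        (A ^ ((1 : ℝ) / 4) /
            (2 * Real.sqrt (π * α ^ (d - 3) * ((d : ℝ) * α ^ (d - 1) + 1))) *
          (n : ℝ) ^ (-(3 : ℝ) / 4) * Real.exp (2 * Real.sqrt (A * n))))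
      atTop (nhds 1) := by
  obtain ⟨hα0, hα1, hαd⟩ := hα
  have hd1 : 1 ≤ d := by omega
  have hd0 : (0 : ℝ) < d := by exact_mod_cast hd1
  have hα' : 1 - α = α ^ d := by linarith
  have hlog : log α < 0 := Real.log_neg hα0 hα1
  have hu : 0 < -log α := by linarith
  have hexpu : exp (- -log α) = α := by rw [neg_neg, Real.exp_log hα0]
  have hu' : log (1 - exp (- -log α)) = -(d * -log α) := by
    rw [hexpu, hα', Real.log_pow]; ring
  have hA0 : 0 < A := by
    have h1 : 0 ≤ ∑' r : ℕ, α ^ ((r + 1) * d) / ((r : ℝ) + 1) ^ 2 :=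
      tsum_nonneg fun r => by positivity
    have h2 : 0 < (d : ℝ) / 2 * (Real.log α) ^ 2 := mul_pos (by positivity) (sq_pos_of_neg hlog)
    rw [hA]; linarith
  have hrate : gapRate d (-log α) = -A := by
    rw [gapRate, logPrimitive, hu', hexpu, hα', dilog, hA]
    simp_rw [pow_mul', ← pow_mul, mul_comm d]
    ring
  set C : ℝ := (√(2 * π * (1 - α)))⁻¹ * exp (((d : ℝ) / 2 - (2 : ℕ)) * -log α) *
      √(π / ((d + α / (1 - α)) / 2)) with hC
  have hα1' : 0 < 1 - α := by linarith
  have hC0 : 0 < C := by positivity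
  have hCsq : C ^ 2 = _ := gapSum_const_sq hd hα0 hα'
  have hseries : ∀ t, 0 < t →
      HasSum (fun n => (qPart d 2 n : ℝ) * exp (-t) ^ n) (gapSum d 2 t) := fun t ht =>
    hasSum_qPart_real hd1 one_le_two (exp_neg_pos_lt_one ht).1 (exp_neg_pos_lt_one ht).2
  have hgap : ∀ t, 0 < t → expSeries (fun n => (qPart d 2 n : ℝ)) t = gapSum d 2 t :=
    fun t ht => (hseries t ht).tsum_eq
  have hlim : Tendsto (fun t => expSeries (fun n => (qPart d 2 n : ℝ)) t * exp (-(A / t)))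
      (nhdsWithin 0 (Set.Ioi 0)) (nhds C) := by
    have h := tendsto_gapSum (a := 2) hd1 hu hu'
    rw [hrate, hexpu] at h
    refine h.congr' ?_
    filter_upwards [self_mem_nhdsWithin] with t ht
    rw [hgap t ht, neg_div]
  obtain ⟨K, hK⟩ := exists_norm_tsum_gapTerm_le hd1 2 hu hu'
  have hminor : ∀ᶠ t in nhdsWithin 0 (Set.Ioi 0), ∀ s : ℝ, |s| * (t * √t) ≤ π →
      ‖∑' n, (((qPart d 2 n : ℝ)) : ℂ) *
        Complex.exp (-t + ((s * (t * √t) : ℝ) : ℂ) * Complex.I) ^ n‖ ≤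
        K * (1 + s ^ 2)⁻¹ * expSeries (fun n => (qPart d 2 n : ℝ)) t := by
    filter_upwards [hK, self_mem_nhdsWithin] with t hKt ht s hs
    have hx : ‖Complex.exp (-t + ((s * (t * √t) : ℝ) : ℂ) * Complex.I)‖ < 1 := by
      rw [norm_cexp_eq]; exact (exp_neg_pos_lt_one ht).2
    rw [hgap t ht]
    simp_rw [Complex.ofReal_natCast]
    rw [(hasSum_qPart_complex hd1 one_le_two (Complex.exp_ne_zero _) hx).tsum_eq]
    exact hKt s hs
  have hmain := tendsto_coeff_of_expSeries hA0 hC0 (fun n => Nat.cast_nonneg _)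
    (fun t ht => (hseries t ht).summable) hlim hminor
  have hL : √(π / A) / (2 * π) * C ≠ 0 := by positivity
  have hdiv := hmain.div_const (√(π / A) / (2 * π) * C)
  rw [div_self hL] at hdiv
  refine hdiv.congr' ?_
  filter_upwards [eventually_gt_atTop 0] with n hn
  have hn : (0 : ℝ) < n := by exact_mod_cast hn
  have hroot : √(π * α ^ (d - 3) * ((d : ℝ) * α ^ (d - 1) + 1)) = √π / C := by
    rw [mul_assoc, ← inv_inv (α ^ (d - 3) * _), ← hCsq, Real.sqrt_mul pi_pos.le,
      Real.sqrt_inv, Real.sqrt_sq hC0.le, div_eq_mul_inv]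
  have hA34 : A ^ ((3 : ℝ) / 4) = A ^ ((1 : ℝ) / 4) * √A := by
    rw [Real.sqrt_eq_rpow, ← Real.rpow_add hA0]; norm_num
  have hπ : √π * √π = π := Real.mul_self_sqrt pi_pos.le
  rw [hroot, sqrt_mul_sqrt_sqrt (by positivity), Real.div_rpow hA0.le hn.le, hA34,
    Real.sqrt_div pi_pos.le, neg_div, Real.rpow_neg hn.le, exp_neg]
  have h1 : 0 < √A := Real.sqrt_pos.2 hA0
  have h2 : 0 < √π := Real.sqrt_pos.2 pi_pos
  have h3 : 0 < A ^ ((1 : ℝ) / 4) := Real.rpow_pos_of_pos hA0 _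
  have h4 : 0 < (n : ℝ) ^ ((3 : ℝ) / 4) := Real.rpow_pos_of_pos hn _
  field_simp
  linear_combination (-(qPart d 2 n : ℝ)) * hπ
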